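/- There exist positive constants N0, a1, a2, c1, c2 depending only on d such that the following holds. Suppose the tasks are drawn from the affine task distribution D(F^aff_L), the noise variance satisfies a1·n^{-d/2} ≤ σ² ≤ a2·n·L², and n ≥ N0 as well as n ≥ N0·(L·(log n)²/σ)^{d+2}. Then every minimizer M* of the softmax-attention ICL pretraining loss L(·) over all of ℝ^{d×d} has the form M* = w·I_d for a scalar w satisfying c1·Λ^{1/(d+4)} ≤ |w| ≤ c2·Λ^{2(d+2)/(d(d+4))}. -/

import Mathlib

open MeasureTheory Real

noncomputable section

/-- Uniform probability measure on the unit sphere `S^{d-1} ⊆ ℝ^d`, defined as the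
normalized `(d-1)`-dimensional Hausdorff measure restricted to the sphere. -/
def sphereUniform (d : ℕ) : Measure (EuclideanSpace ℝ (Fin d)) :=
  ((μH[(d : ℝ) - 1]) (Metric.sphere (0 : EuclideanSpace ℝ (Fin d)) 1))⁻¹ •
    (μH[(d : ℝ) - 1]).restrict (Metric.sphere (0 : EuclideanSpace ℝ (Fin d)) 1)

/-- Uniform probability measure on the interval `[-L, L]`. -/
def unifIcc (L : ℝ) : Measure ℝ :=
  (ENNReal.ofReal (2 * L))⁻¹ • (volume.restrict (Set.Icc (-L) L))

/-- The bilinear form `x ↦ x ⬝ M y`. -/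
def quadForm {d : ℕ} (M : Matrix (Fin d) (Fin d) ℝ)
    (x y : EuclideanSpace ℝ (Fin d)) : ℝ :=
  ∑ a, ∑ b, x a * M a b * y b

/-- The softmax-attention prediction of the label of the query `x (Fin.last n)` given
the context points `x i` with labels `y i`, `i = 1, …, n`. -/
def softmaxPred {d n : ℕ} (M : Matrix (Fin d) (Fin d) ℝ)
    (x : Fin (n + 1) → EuclideanSpace ℝ (Fin d)) (y : Fin n → ℝ) : ℝ :=
  (∑ i : Fin n, y i * Real.exp (quadForm M (x i.castSucc) (x (Fin.last n)))) /
    ∑ i : Fin n, Real.exp (quadForm M (x i.castSucc) (x (Fin.last n)))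

/-- The softmax-attention ICL pretraining population loss: the task parameter `θ` is drawn
from `τ`, the covariates `x_1, …, x_{n+1}` are i.i.d. `sphereUniform d`, and the label
noises `e_1, …, e_n` are i.i.d. with law `ν`; the loss is the expected squared error of the
softmax-attention prediction of the clean label `F θ (x_{n+1})` of the query from the noisy
labelled context `{(x_i, F θ x_i + e_i)}_{i=1}^n`. -/
def iclLoss (d n : ℕ) {Θ : Type*} [MeasurableSpace Θ] (τ : Measure Θ) (ν : Measure ℝ)
    (F : Θ → EuclideanSpace ℝ (Fin d) → ℝ) (M : Matrix (Fin d) (Fin d) ℝ) : ℝ :=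
  ∫ θ, ∫ x : Fin (n + 1) → EuclideanSpace ℝ (Fin d), ∫ e : Fin n → ℝ,
      (softmaxPred M x (fun i => F θ (x i.castSucc) + e i) - F θ (x (Fin.last n))) ^ 2
        ∂(Measure.pi fun _ : Fin n => ν)
      ∂(Measure.pi fun _ : Fin (n + 1) => sphereUniform d) ∂τ

/-- The parameter distribution of the affine task class `D(F^aff_L)`:
`v` uniform on the sphere, `l, b` i.i.d. uniform on `[-L, L]`. -/
def affineTask (d : ℕ) (L : ℝ) : Measure (EuclideanSpace ℝ (Fin d) × ℝ × ℝ) :=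
  (sphereUniform d).prod ((unifIcc L).prod (unifIcc L))

/-- The affine task function `f(x) = l ⬝ vᵀx + b` with parameter `θ = (v, l, b)`. -/
def affineF {d : ℕ} (θ : EuclideanSpace ℝ (Fin d) × ℝ × ℝ)
    (x : EuclideanSpace ℝ (Fin d)) : ℝ :=
  θ.2.1 * (∑ a, θ.1 a * x a) + θ.2.2

section Helpers

open scoped RealInnerProductSpace ENNReal NNReal

/-- Normalisation is `2`-Lipschitz outside the open unit ball. -/
lemma norm_normalize_sub_le {E : Type*} [NormedAddCommGroup E] [NormedSpace ℝ E] {a b : E}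
    (ha : 1 ≤ ‖a‖) (hb : 1 ≤ ‖b‖) : ‖‖a‖⁻¹ • a - ‖b‖⁻¹ • b‖ ≤ 2 * ‖a - b‖ := by
  have ha0 : 0 < ‖a‖ := by linarith
  have hb0 : 0 < ‖b‖ := by linarith
  have h1 : ‖a‖⁻¹ • a - ‖b‖⁻¹ • b = ‖a‖⁻¹ • (a - b) + (‖a‖⁻¹ - ‖b‖⁻¹) • b := by
    rw [smul_sub, sub_smul]; abel
  have h2 : ‖(‖a‖⁻¹ - ‖b‖⁻¹) • b‖ = ‖a‖⁻¹ * |‖b‖ - ‖a‖| := by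
    have : ‖a‖⁻¹ - ‖b‖⁻¹ = ‖a‖⁻¹ * ‖b‖⁻¹ * (‖b‖ - ‖a‖) := by field_simp
    rw [norm_smul, this, Real.norm_eq_abs, abs_mul, abs_of_pos (by positivity)]
    field_simp
  have h3 : |‖b‖ - ‖a‖| ≤ ‖a - b‖ := by
    rw [norm_sub_rev]; exact abs_norm_sub_norm_le b a
  have h4 : ‖a‖⁻¹ ≤ 1 := inv_le_one_of_one_le₀ ha
  rw [h1]
  refine (norm_add_le _ _).trans ?_
  rw [h2, norm_smul, norm_inv, norm_norm]
  have h5 : ‖a‖⁻¹ * ‖a - b‖ ≤ 1 * ‖a - b‖ := by gcongr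
  have h6 : ‖a‖⁻¹ * |‖b‖ - ‖a‖| ≤ 1 * ‖a - b‖ := by gcongr
  linarith

/-- The spherical cap of height `h` around `q`. -/
def sphereCap {d : ℕ} (q : EuclideanSpace ℝ (Fin d)) (h : ℝ) : Set (EuclideanSpace ℝ (Fin d)) :=
  {x | ‖x‖ = 1 ∧ 1 - ⟪x, q⟫ ≤ h}

lemma finrank_orthogonal_unit {d : ℕ} (hd : 2 ≤ d) {q : EuclideanSpace ℝ (Fin d)} (hq : ‖q‖ = 1) :
    Module.finrank ℝ (ℝ ∙ q)ᗮ = d - 1 := by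
  have : Fact (Module.finrank ℝ (EuclideanSpace ℝ (Fin d)) = (d - 1) + 1) :=
    ⟨by rw [finrank_euclideanSpace_fin]; omega⟩
  exact Submodule.finrank_orthogonal_span_singleton (by rintro rfl; simp at hq)

/-- A ball in the hyperplane `q^⊥` has Hausdorff measure proportional to the `(d-1)`-st power of
its radius. -/
lemma exists_hausdorffMeasure_closedBall_orthogonal {d : ℕ} (hd : 2 ≤ d)
    {q : EuclideanSpace ℝ (Fin d)} (hq : ‖q‖ = 1) :
    ∃ c : ℝ, 0 < c ∧ ∀ r : ℝ, 0 ≤ r →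
      μH[(d : ℝ) - 1] (Metric.closedBall (0 : (ℝ ∙ q)ᗮ) r) = ENNReal.ofReal (c * r ^ (d - 1)) := by
  have hk := finrank_orthogonal_unit hd hq
  have hdim : (d : ℝ) - 1 = ((Module.finrank ℝ (ℝ ∙ q)ᗮ : ℕ) : ℝ) := by
    rw [hk, Nat.cast_sub (by omega)]; simp
  rw [hdim]
  set ν : Measure (ℝ ∙ q)ᗮ := μH[((Module.finrank ℝ (ℝ ∙ q)ᗮ : ℕ) : ℝ)] with hν
  have : ν.IsAddHaarMeasure := isAddHaarMeasure_hausdorffMeasure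
  have hpos : 0 < ν (Metric.ball 0 1) := Metric.measure_ball_pos ν 0 one_pos
  have hfin : ν (Metric.ball 0 1) ≠ ⊤ := measure_ball_lt_top.ne
  refine ⟨(ν (Metric.ball 0 1)).toReal, ENNReal.toReal_pos hpos.ne' hfin, fun r hr => ?_⟩
  rw [Measure.addHaar_closedBall ν 0 hr, hk, ENNReal.ofReal_mul ENNReal.toReal_nonneg,
    ENNReal.ofReal_toReal hfin, mul_comm]

lemma sqrt_pow_eq_rpow {d : ℕ} (hd : 2 ≤ d) {h : ℝ} (hh : 0 ≤ h) :
    √h ^ (d - 1) = h ^ (((d : ℝ) - 1) / 2) := by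
  rw [Real.sqrt_eq_rpow, ← Real.rpow_natCast, ← Real.rpow_mul hh, Nat.cast_sub (by omega)]
  congr 1; push_cast; ring

lemma exists_hausdorffMeasure_cap_ge {d : ℕ} (hd : 2 ≤ d)
    {q : EuclideanSpace ℝ (Fin d)} (hq : ‖q‖ = 1) :
    ∃ c : ℝ, 0 < c ∧ ∀ h : ℝ, 0 ≤ h → h ≤ 1 →
      ENNReal.ofReal (c * h ^ (((d : ℝ) - 1) / 2)) ≤ μH[(d : ℝ) - 1] (sphereCap q h) := by
  obtain ⟨c, hc, hball⟩ := exists_hausdorffMeasure_closedBall_orthogonal hd hq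
  refine ⟨c, hc, fun h h0 h1 => ?_⟩
  rw [← sqrt_pow_eq_rpow hd h0, ← hball _ (Real.sqrt_nonneg h)]
  have hlip : LipschitzWith 1 (ℝ ∙ q)ᗮ.orthogonalProjectionOnto :=
    Submodule.lipschitzWith_orthogonalProjectionOnto _
  have hd0 : (0 : ℝ) ≤ (d : ℝ) - 1 := by
    have : (2 : ℝ) ≤ d := by exact_mod_cast hd
    linarith
  refine le_trans (measure_mono ?_) ((hlip.hausdorffMeasure_image_le hd0 (sphereCap q h)).trans
    (by simp))
  intro y hy
  rw [mem_closedBall_zero_iff] at hy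
  have hy2 : ‖(y : EuclideanSpace ℝ (Fin d))‖ ^ 2 ≤ h := by
    have := Real.sq_sqrt h0
    have h3 : ‖(y : EuclideanSpace ℝ (Fin d))‖ ≤ √h := hy
    nlinarith [norm_nonneg (y : EuclideanSpace ℝ (Fin d)), Real.sqrt_nonneg h]
  set s := √(1 - ‖(y : EuclideanSpace ℝ (Fin d))‖ ^ 2) with hs
  have hs2 : s ^ 2 = 1 - ‖(y : EuclideanSpace ℝ (Fin d))‖ ^ 2 := Real.sq_sqrt (by linarith)
  have hs0 : 0 ≤ s := Real.sqrt_nonneg _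
  have hyq : ⟪(y : EuclideanSpace ℝ (Fin d)), q⟫ = 0 := by
    rw [real_inner_comm]; exact Submodule.mem_orthogonal_singleton_iff_inner_right.1 y.2
  have hqq : ⟪q, q⟫ = 1 := by rw [real_inner_self_eq_norm_sq, hq]; norm_num
  refine ⟨(y : EuclideanSpace ℝ (Fin d)) + s • q, ⟨?_, ?_⟩, ?_⟩
  · have : ‖(y : EuclideanSpace ℝ (Fin d)) + s • q‖ ^ 2 = 1 := by
      rw [norm_add_sq_real, inner_smul_right, hyq, norm_smul, hq, Real.norm_eq_abs, mul_pow, sq_abs,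
        hs2]; ring
    nlinarith [norm_nonneg ((y : EuclideanSpace ℝ (Fin d)) + s • q)]
  · rw [inner_add_left, inner_smul_left, hyq, hqq]
    simp only [conj_trivial]
    nlinarith
  · rw [map_add, map_smul]
    have : (ℝ ∙ q)ᗮ.orthogonalProjectionOnto q = 0 := by
      exact Submodule.orthogonalProjectionOnto_orthogonalComplement_singleton_eq_zero q
    rw [this]; simp

lemma exists_hausdorffMeasure_cap_le {d : ℕ} (hd : 2 ≤ d)
    {q : EuclideanSpace ℝ (Fin d)} (hq : ‖q‖ = 1) :
    ∃ C : ℝ, 0 < C ∧ ∀ h : ℝ, 0 ≤ h → h ≤ 1 / 2 →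
      μH[(d : ℝ) - 1] (sphereCap q h) ≤ ENNReal.ofReal (C * h ^ (((d : ℝ) - 1) / 2)) := by
  obtain ⟨c, hc, hball⟩ := exists_hausdorffMeasure_closedBall_orthogonal hd hq
  have hd0 : (0 : ℝ) ≤ (d : ℝ) - 1 := by
    have : (2 : ℝ) ≤ d := by exact_mod_cast hd
    linarith
  have hqq : ⟪q, q⟫ = 1 := by rw [real_inner_self_eq_norm_sq, hq]; norm_num
  let ψ : (ℝ ∙ q)ᗮ → EuclideanSpace ℝ (Fin d) := fun y =>
    ‖q + (y : EuclideanSpace ℝ (Fin d))‖⁻¹ • (q + (y : EuclideanSpace ℝ (Fin d)))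
  have hge : ∀ y : (ℝ ∙ q)ᗮ, 1 ≤ ‖q + (y : EuclideanSpace ℝ (Fin d))‖ := by
    intro y
    have hyq : ⟪q, (y : EuclideanSpace ℝ (Fin d))⟫ = 0 :=
      Submodule.mem_orthogonal_singleton_iff_inner_right.1 y.2
    have : ‖q + (y : EuclideanSpace ℝ (Fin d))‖ ^ 2 = 1 + ‖(y : EuclideanSpace ℝ (Fin d))‖ ^ 2 := by
      rw [norm_add_sq_real, hyq, hq]; ring
    nlinarith [norm_nonneg (q + (y : EuclideanSpace ℝ (Fin d))),
      sq_nonneg ‖(y : EuclideanSpace ℝ (Fin d))‖]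
  have hlip : LipschitzWith 2 ψ := by
    refine LipschitzWith.of_dist_le_mul fun y z => ?_
    rw [dist_eq_norm, dist_eq_norm]
    refine (norm_normalize_sub_le (hge y) (hge z)).trans ?_
    simp
  refine ⟨2 ^ ((d : ℝ) - 1) * (c * √8 ^ (d - 1)), by positivity, fun h h0 h1 => ?_⟩
  have hsub : sphereCap q h ⊆ ψ '' Metric.closedBall 0 (√(8 * h)) := by
    rintro x ⟨hx, hxh⟩
    set t := ⟪x, q⟫ with ht
    have ht2 : 1 / 2 ≤ t := by linarith
    have ht0 : 0 < t := by linarith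
    have ht1 : t ≤ 1 := by
      have := real_inner_le_norm x q
      rw [hx, hq] at this; linarith
    have hmem : t⁻¹ • x - q ∈ (ℝ ∙ q)ᗮ := by
      rw [Submodule.mem_orthogonal_singleton_iff_inner_right, inner_sub_right, inner_smul_right,
        real_inner_comm, ← ht, hqq]
      field_simp; ring
    refine ⟨⟨_, hmem⟩, ?_, ?_⟩
    · rw [mem_closedBall_zero_iff]
      apply Real.le_sqrt_of_sq_le
      change ‖t⁻¹ • x - q‖ ^ 2 ≤ _
      rw [norm_sub_sq_real, inner_smul_left, ← ht, norm_smul, hx, hq]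
      simp only [conj_trivial, norm_inv, Real.norm_eq_abs, abs_of_pos ht0]
      have : (t⁻¹ * 1) ^ 2 - 2 * (t⁻¹ * t) + 1 ^ 2 = (1 - t ^ 2) / t ^ 2 := by field_simp; ring
      rw [this, div_le_iff₀ (by positivity)]
      have h8 : 8 * (1 - t) * t ^ 2 ≤ 8 * h * t ^ 2 := by gcongr
      nlinarith [mul_nonneg (sub_nonneg.2 ht1) (sub_nonneg.2 ht2)]
    · change ‖q + (t⁻¹ • x - q)‖⁻¹ • (q + (t⁻¹ • x - q)) = x
      rw [add_sub_cancel, norm_smul, hx, smul_smul, norm_inv, Real.norm_eq_abs, abs_of_pos ht0]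
      field_simp; simp
  refine (measure_mono hsub).trans ((hlip.hausdorffMeasure_image_le hd0 _).trans ?_)
  rw [hball _ (Real.sqrt_nonneg _), Real.sqrt_mul (by norm_num), mul_pow, sqrt_pow_eq_rpow hd h0]
  have h2 : ((2 : ℝ≥0) : ℝ≥0∞) ^ ((d : ℝ) - 1) = ENNReal.ofReal (2 ^ ((d : ℝ) - 1)) := by
    rw [← ENNReal.ofReal_rpow_of_pos (by norm_num)]; simp
  rw [h2, ← ENNReal.ofReal_mul (by positivity)]
  apply le_of_eq; congr 1; ring

lemma measurableSet_sphereCap {d : ℕ} (q : EuclideanSpace ℝ (Fin d)) (h : ℝ) :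
    MeasurableSet (sphereCap q h) := by
  have h1 : MeasurableSet {x : EuclideanSpace ℝ (Fin d) | ‖x‖ = 1} :=
    measurableSet_eq_fun (by fun_prop) (by fun_prop)
  have h2 : MeasurableSet {x : EuclideanSpace ℝ (Fin d) | 1 - ⟪x, q⟫ ≤ h} :=
    measurableSet_le (by fun_prop) (by fun_prop)
  exact h1.inter h2

lemma sphereCap_subset_sphere {d : ℕ} (q : EuclideanSpace ℝ (Fin d)) (h : ℝ) :
    sphereCap q h ⊆ Metric.sphere 0 1 := fun x hx => by simpa using hx.1

lemma hausdorffMeasure_sphere_lt_top {d : ℕ} (hd : 2 ≤ d) :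
    μH[(d : ℝ) - 1] (Metric.sphere (0 : EuclideanSpace ℝ (Fin d)) 1) < ⊤ := by
  apply (isCompact_sphere _ _).measure_lt_top_of_nhdsWithin
  intro q hq
  have hq1 : ‖q‖ = 1 := by simpa using hq
  obtain ⟨C, hC, h⟩ := exists_hausdorffMeasure_cap_le hd hq1
  refine ⟨sphereCap q (1 / 2), ?_, (h (1 / 2) (by norm_num) le_rfl).trans_lt ENNReal.ofReal_lt_top⟩
  have hopen : {x : EuclideanSpace ℝ (Fin d) | 1 - ⟪x, q⟫ < 1 / 2} ∈ nhds q := by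
    refine (isOpen_lt (by fun_prop) (by fun_prop)).mem_nhds ?_
    simp [hq1]
  filter_upwards [mem_nhdsWithin_of_mem_nhds hopen, self_mem_nhdsWithin] with x hx hx1
  exact ⟨by simpa using hx1, le_of_lt hx⟩

lemma exists_unit_vector {d : ℕ} (hd : 2 ≤ d) : ∃ q : EuclideanSpace ℝ (Fin d), ‖q‖ = 1 :=
  ⟨EuclideanSpace.single ⟨0, by omega⟩ 1, by simp⟩

lemma hausdorffMeasure_sphere_pos {d : ℕ} (hd : 2 ≤ d) :
    0 < μH[(d : ℝ) - 1] (Metric.sphere (0 : EuclideanSpace ℝ (Fin d)) 1) := by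
  obtain ⟨q, hq⟩ := exists_unit_vector hd
  obtain ⟨c, hc, h⟩ := exists_hausdorffMeasure_cap_ge hd hq
  have h1 := h 1 zero_le_one le_rfl
  rw [Real.one_rpow, mul_one] at h1
  exact (ENNReal.ofReal_pos.2 hc).trans_le (h1.trans (measure_mono (sphereCap_subset_sphere q 1)))

lemma isProbabilityMeasure_sphereUniform {d : ℕ} (hd : 2 ≤ d) :
    IsProbabilityMeasure (sphereUniform d) := by
  constructor
  rw [sphereUniform, Measure.smul_apply, Measure.restrict_apply_univ, smul_eq_mul]
  exact ENNReal.inv_mul_cancel (hausdorffMeasure_sphere_pos hd).ne'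
    (hausdorffMeasure_sphere_lt_top hd).ne

lemma ae_norm_eq_one_sphereUniform (d : ℕ) : ∀ᵐ x ∂(sphereUniform d), ‖x‖ = 1 := by
  apply Measure.ae_smul_measure
  filter_upwards [ae_restrict_mem (Metric.isClosed_sphere.measurableSet)] with x hx
  simpa using hx

lemma measurePreserving_sphereUniform {d : ℕ}
    (R : EuclideanSpace ℝ (Fin d) ≃ₗᵢ[ℝ] EuclideanSpace ℝ (Fin d)) :
    MeasurePreserving R (sphereUniform d) (sphereUniform d) := by
  have h := (R.toIsometryEquiv.measurePreserving_hausdorffMeasure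
    ((d : ℝ) - 1)).restrict_preimage
      (s := Metric.sphere (0 : EuclideanSpace ℝ (Fin d)) 1) Metric.isClosed_sphere.measurableSet
  have hpre : R.toIsometryEquiv ⁻¹' Metric.sphere (0 : EuclideanSpace ℝ (Fin d)) 1
      = Metric.sphere 0 1 := by
    ext x; simp
  rw [hpre] at h
  exact h.smul_measure _

/-- Caps of height `h` have measure comparable with `h ^ ((d - 1) / 2)`. -/
lemma exists_sphereUniform_cap_bounds {d : ℕ} (hd : 2 ≤ d) :
    ∃ c C : ℝ, 0 < c ∧ 0 < C ∧ ∀ q : EuclideanSpace ℝ (Fin d), ‖q‖ = 1 → ∀ h : ℝ, 0 < h →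
      (h ≤ 1 → c * h ^ (((d : ℝ) - 1) / 2) ≤ (sphereUniform d).real (sphereCap q h)) ∧
      (sphereUniform d).real (sphereCap q h) ≤ C * h ^ (((d : ℝ) - 1) / 2) := by
  have := isProbabilityMeasure_sphereUniform hd
  obtain ⟨e, he⟩ := exists_unit_vector hd
  obtain ⟨c, hc, hlow⟩ := exists_hausdorffMeasure_cap_ge hd he
  obtain ⟨C, hC, hupp⟩ := exists_hausdorffMeasure_cap_le hd he
  set m := (μH[(d : ℝ) - 1] (Metric.sphere (0 : EuclideanSpace ℝ (Fin d)) 1)).toReal with hm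
  have hm0 : 0 < m := ENNReal.toReal_pos (hausdorffMeasure_sphere_pos hd).ne'
    (hausdorffMeasure_sphere_lt_top hd).ne
  have hρ : 0 ≤ ((d : ℝ) - 1) / 2 := by
    have : (2 : ℝ) ≤ d := by exact_mod_cast hd
    linarith
  have heq : ∀ h, (sphereUniform d).real (sphereCap e h)
      = m⁻¹ * (μH[(d : ℝ) - 1] (sphereCap e h)).toReal := by
    intro h
    rw [sphereUniform, Measure.real, Measure.smul_apply, smul_eq_mul, ENNReal.toReal_mul,
      ENNReal.toReal_inv, Measure.restrict_apply (measurableSet_sphereCap e h),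
      Set.inter_eq_left.2 (sphereCap_subset_sphere e h)]
  have hrot : ∀ q : EuclideanSpace ℝ (Fin d), ‖q‖ = 1 → ∀ h,
      (sphereUniform d).real (sphereCap q h) = (sphereUniform d).real (sphereCap e h) := by
    intro q hq h
    let R := (ℝ ∙ (q - e))ᗮ.reflection
    have hR : R q = e := Submodule.reflection_sub (by rw [hq, he])
    have hpre : R ⁻¹' (sphereCap e h) = sphereCap q h := by
      ext x
      simp only [sphereCap, Set.mem_preimage, Set.mem_ofPred_eq, LinearIsometryEquiv.norm_map]
      rw [← hR, LinearIsometryEquiv.inner_map_map]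
    rw [← hpre]
    exact (measurePreserving_sphereUniform R).measureReal_preimage
      (measurableSet_sphereCap e h).nullMeasurableSet
  refine ⟨m⁻¹ * c, m⁻¹ * C + 2 ^ (((d : ℝ) - 1) / 2), by positivity, by positivity,
    fun q hq h h0 => ⟨fun h1 => ?_, ?_⟩⟩
  · rw [hrot q hq, heq, mul_assoc]
    gcongr
    have hfin : μH[(d : ℝ) - 1] (sphereCap e h) ≠ ⊤ :=
      ((measure_mono (sphereCap_subset_sphere e h)).trans_lt (hausdorffMeasure_sphere_lt_top hd)).ne
    rw [← ENNReal.ofReal_le_iff_le_toReal hfin]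
    exact hlow h h0.le h1
  · rw [hrot q hq]
    have hh : 0 < h ^ (((d : ℝ) - 1) / 2) := by positivity
    rcases le_total h (1 / 2) with h2 | h2
    · have h3 := ENNReal.toReal_mono ENNReal.ofReal_ne_top (hupp h h0.le h2)
      rw [ENNReal.toReal_ofReal (by positivity)] at h3
      rw [heq]
      calc m⁻¹ * (μH[(d : ℝ) - 1] (sphereCap e h)).toReal
          ≤ m⁻¹ * (C * h ^ (((d : ℝ) - 1) / 2)) := by gcongr
        _ ≤ _ := by
          rw [add_mul, mul_assoc]
          have : 0 < (2 : ℝ) ^ (((d : ℝ) - 1) / 2) := by positivity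
          nlinarith [mul_pos this hh]
    · calc (sphereUniform d).real (sphereCap e h) ≤ 1 := measureReal_le_one
        _ ≤ 2 ^ (((d : ℝ) - 1) / 2) * h ^ (((d : ℝ) - 1) / 2) := by
          rw [← Real.mul_rpow (by norm_num) h0.le]
          exact Real.one_le_rpow (by linarith) hρ
        _ ≤ _ := by
          rw [add_mul]
          have : 0 < m⁻¹ * C * h ^ (((d : ℝ) - 1) / 2) := by positivity
          linarith

lemma integrable_of_continuous_of_ae_mem_compact {X F : Type*} [TopologicalSpace X]
    [MeasurableSpace X] [OpensMeasurableSpace X] [NormedAddCommGroup F]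
    [SecondCountableTopology F] [MeasurableSpace F] [BorelSpace F]
    {μ : Measure X} [IsFiniteMeasure μ] {K : Set X}
    (hK : IsCompact K) (hμ : ∀ᵐ x ∂μ, x ∈ K) {f : X → F} (hf : Continuous f) :
    Integrable f μ := by
  obtain ⟨C, hC⟩ := hK.exists_bound_of_continuousOn hf.continuousOn
  refine Integrable.of_bound hf.measurable.aestronglyMeasurable C ?_
  filter_upwards [hμ] with x hx using hC x hx

lemma integrable_sphereUniform {d : ℕ} (hd : 2 ≤ d) {F : Type*} [NormedAddCommGroup F]
    [SecondCountableTopology F] [MeasurableSpace F] [BorelSpace F]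
    {f : EuclideanSpace ℝ (Fin d) → F} (hf : Continuous f) :
    Integrable f (sphereUniform d) := by
  have := isProbabilityMeasure_sphereUniform hd
  refine integrable_of_continuous_of_ae_mem_compact (isCompact_sphere 0 1) ?_ hf
  filter_upwards [ae_norm_eq_one_sphereUniform d] with x hx
  simpa using hx

/-- The Laplace transform at `w` of the height `1 - ⟪x, q⟫` of a uniform point of the sphere. -/
def heightLaplace {d : ℕ} (q : EuclideanSpace ℝ (Fin d)) (w : ℝ) : ℝ :=
  ∫ x, exp (-(w * (1 - ⟪x, q⟫))) ∂(sphereUniform d)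

/-- The derivative-type moment `E[u e^{-wu}]` for the height `u = 1 - ⟪x, q⟫`. -/
def heightMoment {d : ℕ} (q : EuclideanSpace ℝ (Fin d)) (w : ℝ) : ℝ :=
  ∫ x, (1 - ⟪x, q⟫) * exp (-(w * (1 - ⟪x, q⟫))) ∂(sphereUniform d)

lemma height_nonneg {d : ℕ} {q x : EuclideanSpace ℝ (Fin d)} (hq : ‖q‖ = 1) (hx : ‖x‖ = 1) :
    0 ≤ 1 - ⟪x, q⟫ := by
  have := real_inner_le_norm x q
  rw [hx, hq] at this; linarith

lemma heightLaplace_nonneg {d : ℕ} (q : EuclideanSpace ℝ (Fin d)) (w : ℝ) :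
    0 ≤ heightLaplace q w := integral_nonneg fun _ => (exp_pos _).le

lemma heightLaplace_le_one {d : ℕ} (hd : 2 ≤ d) {q : EuclideanSpace ℝ (Fin d)} (hq : ‖q‖ = 1)
    {w : ℝ} (hw : 0 ≤ w) : heightLaplace q w ≤ 1 := by
  have := isProbabilityMeasure_sphereUniform hd
  have h : heightLaplace q w ≤ ∫ x, (1 : ℝ) ∂(sphereUniform d) := by
    refine integral_mono_ae (integrable_sphereUniform hd (by fun_prop)) (integrable_const _) ?_
    filter_upwards [ae_norm_eq_one_sphereUniform d] with x hx
    rw [exp_le_one_iff]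
    have := mul_nonneg hw (height_nonneg hq hx)
    linarith
  simpa using h

lemma integrable_indicator_sphereCap {d : ℕ} (hd : 2 ≤ d) (q : EuclideanSpace ℝ (Fin d)) (h : ℝ) :
    Integrable ((sphereCap q h).indicator fun _ => (1 : ℝ)) (sphereUniform d) := by
  have := isProbabilityMeasure_sphereUniform hd
  exact (integrable_const _).indicator (measurableSet_sphereCap q h)

lemma integral_indicator_sphereCap {d : ℕ} (q : EuclideanSpace ℝ (Fin d)) (h : ℝ) :
    ∫ x, (sphereCap q h).indicator (fun _ => (1 : ℝ)) x ∂(sphereUniform d)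
      = (sphereUniform d).real (sphereCap q h) :=
  integral_indicator_one (measurableSet_sphereCap q h)

lemma exists_heightLaplace_ge {d : ℕ} (hd : 2 ≤ d) :
    ∃ c : ℝ, 0 < c ∧ ∀ q : EuclideanSpace ℝ (Fin d), ‖q‖ = 1 → ∀ w : ℝ, 1 ≤ w →
      c * w ^ (-(((d : ℝ) - 1) / 2)) ≤ heightLaplace q w := by
  obtain ⟨c, C, hc, hC, hcap⟩ := exists_sphereUniform_cap_bounds hd
  refine ⟨exp (-1) * c, by positivity, fun q hq w hw => ?_⟩
  have hw0 : 0 < w := by linarith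
  have h1 := (hcap q hq w⁻¹ (by positivity)).1 (inv_le_one_of_one_le₀ hw)
  rw [Real.inv_rpow hw0.le, ← Real.rpow_neg hw0.le] at h1
  calc exp (-1) * c * w ^ (-(((d : ℝ) - 1) / 2))
      ≤ exp (-1) * (sphereUniform d).real (sphereCap q w⁻¹) := by
        rw [mul_assoc]; gcongr
    _ = ∫ x, exp (-1) * (sphereCap q w⁻¹).indicator (fun _ => (1 : ℝ)) x ∂(sphereUniform d) := by
        rw [integral_const_mul, integral_indicator_sphereCap]
    _ ≤ _ := by
        refine integral_mono ((integrable_indicator_sphereCap hd q _).const_mul _)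
          (integrable_sphereUniform hd (by fun_prop)) fun x => ?_
        by_cases hx : x ∈ sphereCap q w⁻¹
        · simp only [Set.indicator_of_mem hx, mul_one]
          rw [exp_le_exp, neg_le_neg_iff]
          calc w * (1 - ⟪x, q⟫) ≤ w * w⁻¹ := by gcongr; exact hx.2
            _ = 1 := by field_simp
        · simp only [Set.indicator_of_notMem hx, mul_zero]
          positivity

lemma exists_heightLaplace_le {d : ℕ} (hd : 2 ≤ d) :
    ∃ C : ℝ, 0 < C ∧ ∀ q : EuclideanSpace ℝ (Fin d), ‖q‖ = 1 → ∀ w : ℝ, 0 < w →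
      heightLaplace q w ≤ C * w ^ (-(((d : ℝ) - 1) / 2)) := by
  obtain ⟨c, C, hc, hC, hcap⟩ := exists_sphereUniform_cap_bounds hd
  set ρ := ((d : ℝ) - 1) / 2 with hρ
  have hρ0 : 0 < ρ := by
    have : (2 : ℝ) ≤ d := by exact_mod_cast hd
    rw [hρ]; linarith
  set K := 2 * ((ρ + 1) * Real.log 2) with hK
  have hlog : 0 < Real.log 2 := Real.log_pos (by norm_num)
  have hK0 : 0 < K := by positivity
  have hKexp : exp (-(K / 2)) * 2 ^ ρ = 1 / 2 := by
    rw [Real.rpow_def_of_pos (by norm_num), ← Real.exp_add]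
    have : -(K / 2) + Real.log 2 * ρ = -Real.log 2 := by rw [hK]; ring
    rw [this, Real.exp_neg, Real.exp_log (by norm_num)]; norm_num
  set D := 1 + 2 * (C * K ^ ρ) with hD
  have hD0 : 0 < D := by positivity
  refine ⟨D, hD0, fun q hq => ?_⟩
  have key : ∀ k : ℕ, ∀ w : ℝ, 0 < w → w ≤ 2 ^ k → heightLaplace q w * w ^ ρ ≤ D := by
    have base : ∀ w : ℝ, 0 < w → w ≤ 1 → heightLaplace q w * w ^ ρ ≤ D := by
      intro w hw hw1
      have h1 := heightLaplace_le_one hd hq hw.le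
      have h2 : w ^ ρ ≤ 1 := Real.rpow_le_one hw.le hw1 hρ0.le
      have h3 : heightLaplace q w * w ^ ρ ≤ 1 * 1 := by
        gcongr
      have : 0 < C * K ^ ρ := by positivity
      linarith
    intro k
    induction k with
    | zero => simpa using base
    | succ k ih =>
      intro w hw hwk
      have h2 : heightLaplace q (w / 2) * (w / 2) ^ ρ ≤ D :=
        ih (w / 2) (by positivity) (by rw [pow_succ] at hwk; linarith)
      have h3 : heightLaplace q w ≤ (sphereUniform d).real (sphereCap q (K / w))
          + exp (-(K / 2)) * heightLaplace q (w / 2) := by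
        rw [← integral_indicator_sphereCap, heightLaplace, heightLaplace, ← integral_const_mul,
          ← integral_add (integrable_indicator_sphereCap hd q _)
            ((integrable_sphereUniform hd (by fun_prop)).const_mul _)]
        refine integral_mono_ae (integrable_sphereUniform hd (by fun_prop))
          ((integrable_indicator_sphereCap hd q _).add
            ((integrable_sphereUniform hd (by fun_prop)).const_mul _)) ?_
        filter_upwards [ae_norm_eq_one_sphereUniform d] with x hx
        have hu := height_nonneg hq hx
        by_cases hxc : x ∈ sphereCap q (K / w)
        · simp only [Set.indicator_of_mem hxc]
          have : exp (-(w * (1 - ⟪x, q⟫))) ≤ 1 := by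
            rw [exp_le_one_iff]
            have := mul_nonneg hw.le hu
            linarith
          have : 0 < exp (-(K / 2)) * exp (-(w / 2 * (1 - ⟪x, q⟫))) := by positivity
          linarith
        · simp only [Set.indicator_of_notMem hxc, zero_add]
          rw [← Real.exp_add, exp_le_exp]
          have h4 : K / w < 1 - ⟪x, q⟫ := by
            by_contra h5
            exact hxc ⟨hx, not_lt.1 h5⟩
          rw [div_lt_iff₀ hw] at h4
          linarith
      have h4 := (hcap q hq (K / w) (by positivity)).2
      rw [Real.div_rpow hK0.le hw.le] at h4
      have hwρ : 0 < w ^ ρ := by positivity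
      rw [Real.div_rpow hw.le (by norm_num)] at h2
      have h5 : heightLaplace q (w / 2) * w ^ ρ ≤ D * 2 ^ ρ := by
        rwa [← mul_div_assoc, div_le_iff₀ (by positivity)] at h2
      calc heightLaplace q w * w ^ ρ
          ≤ (C * (K ^ ρ / w ^ ρ) + exp (-(K / 2)) * heightLaplace q (w / 2)) * w ^ ρ := by
            gcongr; exact h3.trans (by gcongr)
        _ = C * K ^ ρ + exp (-(K / 2)) * (heightLaplace q (w / 2) * w ^ ρ) := by
            field_simp
        _ ≤ C * K ^ ρ + exp (-(K / 2)) * (D * 2 ^ ρ) := by gcongr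
        _ = C * K ^ ρ + (exp (-(K / 2)) * 2 ^ ρ) * D := by ring
        _ ≤ D := by rw [hKexp, hD]; linarith
  intro w hw
  obtain ⟨k, hk⟩ := pow_unbounded_of_one_lt w (one_lt_two)
  have := key k w hw hk.le
  rw [Real.rpow_neg hw.le, ← div_eq_mul_inv, le_div_iff₀ (by positivity)]
  exact this

lemma exists_heightMoment_le {d : ℕ} (hd : 2 ≤ d) :
    ∃ C : ℝ, 0 < C ∧ ∀ q : EuclideanSpace ℝ (Fin d), ‖q‖ = 1 → ∀ w : ℝ, 0 < w →
      heightMoment q w ≤ C * (w⁻¹ * w ^ (-(((d : ℝ) - 1) / 2))) := by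
  obtain ⟨C, hC, h⟩ := exists_heightLaplace_le hd
  refine ⟨2 * (C * 2 ^ (((d : ℝ) - 1) / 2)), by positivity, fun q hq w hw => ?_⟩
  have h1 : heightMoment q w ≤ 2 * w⁻¹ * heightLaplace q (w / 2) := by
    rw [heightLaplace, heightMoment, ← integral_const_mul]
    refine integral_mono (integrable_sphereUniform hd (by fun_prop))
      ((integrable_sphereUniform hd (by fun_prop)).const_mul _) fun x => ?_
    have h2 : exp (-(w * (1 - ⟪x, q⟫))) =
        exp (-(w / 2 * (1 - ⟪x, q⟫))) * exp (-(w / 2 * (1 - ⟪x, q⟫))) := by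
      rw [← Real.exp_add]; congr 1; ring
    have h3 : (w / 2 * (1 - ⟪x, q⟫)) * exp (-(w / 2 * (1 - ⟪x, q⟫))) ≤ 1 := by
      have h5 := Real.add_one_le_exp (w / 2 * (1 - ⟪x, q⟫))
      rw [Real.exp_neg, ← div_eq_mul_inv, div_le_one (by positivity)]
      linarith
    have h4 := exp_pos (-(w / 2 * (1 - ⟪x, q⟫)))
    have h6 : (1 - ⟪x, q⟫) = 2 * w⁻¹ * (w / 2 * (1 - ⟪x, q⟫)) := by field_simp
    simp only []
    rw [h2]
    calc (1 - ⟪x, q⟫) * (exp (-(w / 2 * (1 - ⟪x, q⟫))) * exp (-(w / 2 * (1 - ⟪x, q⟫))))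
        = (2 * w⁻¹) * ((w / 2 * (1 - ⟪x, q⟫)) * exp (-(w / 2 * (1 - ⟪x, q⟫)))) *
          exp (-(w / 2 * (1 - ⟪x, q⟫))) := by
            conv_lhs => rw [h6]
            ring_nf
            field_simp
      _ ≤ (2 * w⁻¹) * 1 * exp (-(w / 2 * (1 - ⟪x, q⟫))) := by gcongr
      _ = _ := by ring
  refine h1.trans ?_
  have h2 := h q hq (w / 2) (by positivity)
  rw [Real.div_rpow hw.le (by norm_num), Real.rpow_neg (by norm_num : (0 : ℝ) ≤ 2), div_inv_eq_mul] at h2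
  calc 2 * w⁻¹ * heightLaplace q (w / 2)
      ≤ 2 * w⁻¹ * (C * (w ^ (-(((d : ℝ) - 1) / 2)) * 2 ^ (((d : ℝ) - 1) / 2))) := by gcongr
    _ = _ := by ring

lemma exists_heightMoment_ge {d : ℕ} (hd : 2 ≤ d) :
    ∃ c : ℝ, 0 < c ∧ ∀ q : EuclideanSpace ℝ (Fin d), ‖q‖ = 1 → ∀ w : ℝ, 1 ≤ w →
      c * (w⁻¹ * heightLaplace q w) ≤ heightMoment q w := by
  obtain ⟨_, C, _, hC, hcap⟩ := exists_sphereUniform_cap_bounds hd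
  obtain ⟨c, hc, hlow⟩ := exists_heightLaplace_ge hd
  set ρ := ((d : ℝ) - 1) / 2 with hρ
  have hρ0 : 0 < ρ := by
    have : (2 : ℝ) ≤ d := by exact_mod_cast hd
    rw [hρ]; linarith
  set η := (c / (2 * C)) ^ ρ⁻¹ with hη
  have hη0 : 0 < η := by positivity
  have hηρ : C * η ^ ρ = c / 2 := by
    rw [hη, ← Real.rpow_mul (by positivity), inv_mul_cancel₀ hρ0.ne', Real.rpow_one]
    field_simp
  refine ⟨η / 2, by positivity, fun q hq w hw => ?_⟩
  have hw0 : 0 < w := by linarith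
  have h1 : η / w * (heightLaplace q w - (sphereUniform d).real (sphereCap q (η / w)))
      ≤ heightMoment q w := by
    rw [← integral_indicator_sphereCap, heightLaplace, heightMoment,
      ← integral_sub (integrable_sphereUniform hd (by fun_prop))
        (integrable_indicator_sphereCap hd q _), ← integral_const_mul]
    refine integral_mono_ae (((integrable_sphereUniform hd (by fun_prop)).sub
        (integrable_indicator_sphereCap hd q _)).const_mul _)
        (integrable_sphereUniform hd (by fun_prop)) ?_
    filter_upwards [ae_norm_eq_one_sphereUniform d] with x hx
    have hu := height_nonneg hq hx
    by_cases hxc : x ∈ sphereCap q (η / w)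
    · simp only [Set.indicator_of_mem hxc]
      have h2 : exp (-(w * (1 - ⟪x, q⟫))) - 1 ≤ 0 := by
        rw [sub_nonpos, exp_le_one_iff]
        have := mul_nonneg hw0.le hu
        linarith
      have h3 : 0 ≤ (1 - ⟪x, q⟫) * exp (-(w * (1 - ⟪x, q⟫))) := by positivity
      have h4 : 0 < η / w := by positivity
      nlinarith
    · simp only [Set.indicator_of_notMem hxc, sub_zero]
      have h4 : η / w < 1 - ⟪x, q⟫ := by
        by_contra h5
        exact hxc ⟨hx, not_lt.1 h5⟩
      gcongr
  have h2 := (hcap q hq (η / w) (by positivity)).2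
  have h3 := hlow q hq w hw
  rw [Real.div_rpow hη0.le hw0.le, ← mul_div_assoc, hηρ, div_eq_mul_inv (c / 2),
    ← Real.rpow_neg hw0.le] at h2
  calc η / 2 * (w⁻¹ * heightLaplace q w) = η / w * (heightLaplace q w / 2) := by
        field_simp
    _ ≤ η / w * (heightLaplace q w - (sphereUniform d).real (sphereCap q (η / w))) := by
        gcongr; linarith
    _ ≤ _ := h1

/-- The law of `n` i.i.d. uniform covariates on the sphere. -/
def sphereSample (d n : ℕ) : Measure (Fin n → EuclideanSpace ℝ (Fin d)) :=
  Measure.pi fun _ : Fin n => sphereUniform d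

/-- The softmax weight of the `i`-th context point when the query is mapped to `u`. -/
def attnWeight {d n : ℕ} (u : EuclideanSpace ℝ (Fin d)) (x : Fin n → EuclideanSpace ℝ (Fin d))
    (i : Fin n) : ℝ :=
  exp ⟪x i, u⟫ / ∑ j, exp ⟪x j, u⟫

/-- The softmax-weighted mean of the covariates. -/
def attnMean {d n : ℕ} (u : EuclideanSpace ℝ (Fin d)) (x : Fin n → EuclideanSpace ℝ (Fin d)) :
    EuclideanSpace ℝ (Fin d) :=
  ∑ i, attnWeight u x i • x i

section Weights

variable {d n : ℕ}

lemma sum_exp_pos (hn : 0 < n) (f : Fin n → ℝ) : 0 < ∑ j, exp (f j) := by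
  have : Nonempty (Fin n) := ⟨⟨0, hn⟩⟩
  exact Finset.sum_pos (fun _ _ => exp_pos _) Finset.univ_nonempty

lemma attnWeight_pos (hn : 0 < n) (u : EuclideanSpace ℝ (Fin d))
    (x : Fin n → EuclideanSpace ℝ (Fin d)) (i : Fin n) : 0 < attnWeight u x i :=
  div_pos (exp_pos _) (sum_exp_pos hn _)

lemma sum_attnWeight (hn : 0 < n) (u : EuclideanSpace ℝ (Fin d))
    (x : Fin n → EuclideanSpace ℝ (Fin d)) : ∑ i, attnWeight u x i = 1 := by
  simp only [attnWeight]
  rw [← Finset.sum_div, div_self (sum_exp_pos hn _).ne']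

lemma continuous_attnWeight (hn : 0 < n) (i : Fin n) :
    Continuous fun z : EuclideanSpace ℝ (Fin d) × (Fin n → EuclideanSpace ℝ (Fin d)) =>
      attnWeight z.1 z.2 i := by
  unfold attnWeight
  exact Continuous.div (by fun_prop) (by fun_prop) fun z => (sum_exp_pos hn _).ne'

lemma continuous_attnMean (hn : 0 < n) :
    Continuous fun z : EuclideanSpace ℝ (Fin d) × (Fin n → EuclideanSpace ℝ (Fin d)) =>
      attnMean z.1 z.2 := by
  have h : ∀ i : Fin n, Continuous
      fun z : EuclideanSpace ℝ (Fin d) × (Fin n → EuclideanSpace ℝ (Fin d)) => z.2 i :=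
    fun i => (continuous_apply i).comp continuous_snd
  exact continuous_finsetSum Finset.univ fun i _ => (continuous_attnWeight hn i).smul (h i)

lemma continuous_attnWeight_right (hn : 0 < n) (u : EuclideanSpace ℝ (Fin d)) (i : Fin n) :
    Continuous fun x : Fin n → EuclideanSpace ℝ (Fin d) => attnWeight u x i :=
  (continuous_attnWeight hn i).comp (Continuous.prodMk_right u)

lemma continuous_attnMean_right (hn : 0 < n) (u : EuclideanSpace ℝ (Fin d)) :
    Continuous fun x : Fin n → EuclideanSpace ℝ (Fin d) => attnMean u x :=
  continuous_finsetSum Finset.univ fun i _ =>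
    (continuous_attnWeight_right hn u i).smul (continuous_apply i)

lemma attnWeight_map (R : EuclideanSpace ℝ (Fin d) ≃ₗᵢ[ℝ] EuclideanSpace ℝ (Fin d))
    (u : EuclideanSpace ℝ (Fin d)) (x : Fin n → EuclideanSpace ℝ (Fin d)) (i : Fin n) :
    attnWeight (R u) (fun j => R (x j)) i = attnWeight u x i := by
  simp [attnWeight]

lemma attnMean_map (R : EuclideanSpace ℝ (Fin d) ≃ₗᵢ[ℝ] EuclideanSpace ℝ (Fin d))
    (u : EuclideanSpace ℝ (Fin d)) (x : Fin n → EuclideanSpace ℝ (Fin d)) :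
    attnMean (R u) (fun j => R (x j)) = R (attnMean u x) := by
  simp [attnMean, attnWeight_map]

lemma attnWeight_smul (w : ℝ) (q : EuclideanSpace ℝ (Fin d))
    (x : Fin n → EuclideanSpace ℝ (Fin d)) (i : Fin n) :
    attnWeight (w • q) x i
      = exp (-(w * (1 - ⟪x i, q⟫))) / ∑ j, exp (-(w * (1 - ⟪x j, q⟫))) := by
  have h : ∀ j, exp ⟪x j, w • q⟫ = exp w * exp (-(w * (1 - ⟪x j, q⟫))) := by
    intro j
    rw [← Real.exp_add, inner_smul_right]; congr 1; ring
  simp only [attnWeight, h]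
  rw [← Finset.mul_sum, mul_div_mul_left _ _ (exp_pos w).ne']

end Weights

section Sample

variable {d n : ℕ}

lemma isProbabilityMeasure_sphereSample (hd : 2 ≤ d) :
    IsProbabilityMeasure (sphereSample d n) := by
  have := isProbabilityMeasure_sphereUniform hd
  unfold sphereSample; infer_instance

lemma ae_norm_eq_one_sphereSample (hd : 2 ≤ d) :
    ∀ᵐ x ∂(sphereSample d n), ∀ i, ‖x i‖ = 1 := by
  have := isProbabilityMeasure_sphereUniform hd
  rw [ae_all_iff]
  intro i
  exact (measurePreserving_eval (fun _ : Fin n => sphereUniform d) i).quasiMeasurePreserving.ae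
    (ae_norm_eq_one_sphereUniform d)

lemma integrable_sphereSample (hd : 2 ≤ d) {F : Type*} [NormedAddCommGroup F]
    [SecondCountableTopology F] [MeasurableSpace F] [BorelSpace F]
    {f : (Fin n → EuclideanSpace ℝ (Fin d)) → F} (hf : Continuous f) :
    Integrable f (sphereSample d n) := by
  have := isProbabilityMeasure_sphereSample (n := n) hd
  refine integrable_of_continuous_of_ae_mem_compact
    (isCompact_univ_pi fun _ : Fin n => isCompact_sphere (0 : EuclideanSpace ℝ (Fin d)) 1) ?_ hf
  filter_upwards [ae_norm_eq_one_sphereSample hd] with x hx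
  intro i _
  simpa using hx i

lemma integral_sphereSample_map (hd : 2 ≤ d)
    (R : EuclideanSpace ℝ (Fin d) ≃ₗᵢ[ℝ] EuclideanSpace ℝ (Fin d))
    {f : (Fin n → EuclideanSpace ℝ (Fin d)) → ℝ} (hf : Continuous f) :
    ∫ x, f (fun j => R (x j)) ∂(sphereSample d n) = ∫ x, f x ∂(sphereSample d n) := by
  have := isProbabilityMeasure_sphereUniform hd
  have h : MeasurePreserving (fun (x : Fin n → EuclideanSpace ℝ (Fin d)) j => R (x j))
      (sphereSample d n) (sphereSample d n) :=
    measurePreserving_pi _ _ fun _ => measurePreserving_sphereUniform R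
  have h2 := integral_map (μ := sphereSample d n) h.measurable.aemeasurable (f := f)
    hf.measurable.aestronglyMeasurable
  rw [h.map_eq] at h2
  exact h2.symm

lemma integral_eval_sphereSample (hd : 2 ≤ d) {f : EuclideanSpace ℝ (Fin d) → ℝ}
    (hf : Continuous f) (i : Fin n) :
    ∫ x, f (x i) ∂(sphereSample d n) = ∫ x, f x ∂(sphereUniform d) := by
  have := isProbabilityMeasure_sphereUniform hd
  have h := measurePreserving_eval (fun _ : Fin n => sphereUniform d) i
  have h2 := integral_map (μ := sphereSample d n) h.measurable.aemeasurable (f := f)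
    hf.measurable.aestronglyMeasurable
  rw [sphereSample, h.map_eq] at h2
  exact h2.symm

lemma integral_eval_mul_eval_sphereSample (hd : 2 ≤ d) {f g : EuclideanSpace ℝ (Fin d) → ℝ}
    (hf : Continuous f) (hg : Continuous g) {i j : Fin n} (hij : i ≠ j) :
    ∫ x, f (x i) * g (x j) ∂(sphereSample d n)
      = (∫ x, f x ∂(sphereUniform d)) * ∫ x, g x ∂(sphereUniform d) := by
  have := isProbabilityMeasure_sphereUniform hd
  have hind : ProbabilityTheory.iIndepFun
      (fun (i : Fin n) (x : Fin n → EuclideanSpace ℝ (Fin d)) => x i) (sphereSample d n) :=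
    ProbabilityTheory.iIndepFun_pi (X := fun _ x => x) fun _ => aemeasurable_id
  have h := ((hind.indepFun hij).comp hf.measurable hg.measurable).integral_mul_eq_mul_integral
    (hf.comp (continuous_apply i)).measurable.aestronglyMeasurable
    (hg.comp (continuous_apply j)).measurable.aestronglyMeasurable
  rw [← integral_eval_sphereSample hd hf i, ← integral_eval_sphereSample hd hg j]
  exact h

lemma integral_sum_sphereSample (hd : 2 ≤ d) {f : EuclideanSpace ℝ (Fin d) → ℝ}
    (hf : Continuous f) :
    ∫ x, ∑ i, f (x i) ∂(sphereSample d n) = n * ∫ x, f x ∂(sphereUniform d) := by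
  rw [integral_finsetSum _ fun i _ => integrable_sphereSample hd (by fun_prop)]
  simp [integral_eval_sphereSample hd hf]

lemma integral_sum_mul_sum_sphereSample (hd : 2 ≤ d) {f g : EuclideanSpace ℝ (Fin d) → ℝ}
    (hf : Continuous f) (hg : Continuous g) :
    ∫ x, (∑ i, f (x i)) * (∑ i, g (x i)) ∂(sphereSample d n)
      = n * (∫ x, f x * g x ∂(sphereUniform d)) +
        n * (n - 1) * ((∫ x, f x ∂(sphereUniform d)) * ∫ x, g x ∂(sphereUniform d)) := by
  simp_rw [Finset.sum_mul_sum]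
  rw [integral_finsetSum _ fun i _ => integrable_sphereSample hd (by fun_prop)]
  have h : ∀ i : Fin n, ∫ x, ∑ j, f (x i) * g (x j) ∂(sphereSample d n)
      = (∫ x, f x * g x ∂(sphereUniform d)) +
        (n - 1) * ((∫ x, f x ∂(sphereUniform d)) * ∫ x, g x ∂(sphereUniform d)) := by
    intro i
    rw [integral_finsetSum _ fun j _ => integrable_sphereSample hd (by fun_prop),
      ← Finset.add_sum_erase _ _ (Finset.mem_univ i)]
    congr 1
    · exact integral_eval_sphereSample hd (f := fun x => f x * g x) (by fun_prop) i
    · rw [Finset.sum_congr rfl fun j hj =>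
        integral_eval_mul_eval_sphereSample hd hf hg (Finset.ne_of_mem_erase hj).symm]
      rw [Finset.sum_const, Finset.card_erase_of_mem (Finset.mem_univ i), Finset.card_univ,
        Fintype.card_fin, nsmul_eq_mul, Nat.cast_sub (by have := i.2; omega)]
      simp
  simp only [h, Finset.sum_const, Finset.card_univ, Fintype.card_fin, nsmul_eq_mul]
  ring

end Sample

section Monotonicity

/-- The mean of an exponentially tilted empirical distribution is monotone in the tilt. -/
lemma tilted_mean_monotone {n : ℕ} (hn : 0 < n) (t : Fin n → ℝ) :
    Monotone fun w : ℝ => (∑ i, t i * exp (w * t i)) / ∑ i, exp (w * t i) := by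
  intro w w' hw
  simp only []
  rw [div_le_div_iff₀ (sum_exp_pos hn _) (sum_exp_pos hn _)]
  have h1 : ∀ i j, 0 ≤ (t i - t j) *
      (exp (w' * t i) * exp (w * t j) - exp (w * t i) * exp (w' * t j)) := by
    intro i j
    rw [← Real.exp_add, ← Real.exp_add]
    rcases le_total (t i) (t j) with h | h
    · refine mul_nonneg_of_nonpos_of_nonpos (by linarith) (sub_nonpos.2 (exp_le_exp.2 ?_))
      nlinarith
    · refine mul_nonneg (by linarith) (sub_nonneg.2 (exp_le_exp.2 ?_))
      nlinarith
  have h2 : 0 ≤ ∑ i, ∑ j, (t i - t j) *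
      (exp (w' * t i) * exp (w * t j) - exp (w * t i) * exp (w' * t j)) :=
    Finset.sum_nonneg fun i _ => Finset.sum_nonneg fun j _ => h1 i j
  have h3 : ∑ i, ∑ j, (t i - t j) *
      (exp (w' * t i) * exp (w * t j) - exp (w * t i) * exp (w' * t j))
      = 2 * ((∑ i, t i * exp (w' * t i)) * ∑ i, exp (w * t i)
        - (∑ i, t i * exp (w * t i)) * ∑ i, exp (w' * t i)) := by
    have h4 : ∀ i j, (t i - t j) *
      (exp (w' * t i) * exp (w * t j) - exp (w * t i) * exp (w' * t j))
      = (t i * exp (w' * t i)) * exp (w * t j) - (t i * exp (w * t i)) * exp (w' * t j)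
        - (exp (w' * t i) * (t j * exp (w * t j)) - exp (w * t i) * (t j * exp (w' * t j))) := by
      intro i j; ring
    simp only [h4, Finset.sum_sub_distrib, ← Finset.sum_mul_sum]
    ring
  rw [h3] at h2
  linarith

/-- The collision probability of an exponentially tilted empirical distribution is monotone in
the (nonnegative) tilt. -/
lemma tilted_collision_monotoneOn {n : ℕ} (hn : 0 < n) (t : Fin n → ℝ) :
    MonotoneOn (fun w : ℝ => ∑ i, (exp (w * t i) / ∑ j, exp (w * t j)) ^ 2) (Set.Ici 0) := by
  set S : ℝ → ℝ := fun w => ∑ i, exp (w * t i) with hS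
  set T : ℝ → ℝ := fun w => ∑ i, t i * exp (w * t i) with hT
  have hSpos : ∀ w, 0 < S w := fun w => sum_exp_pos hn _
  have hSd : ∀ w, HasDerivAt S (T w) w := by
    intro w
    have h : ∀ i ∈ (Finset.univ : Finset (Fin n)),
        HasDerivAt (fun w => exp (w * t i)) (t i * exp (w * t i)) w := by
      intro i _
      have := ((hasDerivAt_id w).mul_const (t i)).exp
      simpa [mul_comm] using this
    exact HasDerivAt.fun_sum h
  have hG : ∀ w, HasDerivAt (fun w => Real.log (S (2 * w)) - 2 * Real.log (S w))
      (2 * (T (2 * w) / S (2 * w) - T w / S w)) w := by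
    intro w
    have h1 : HasDerivAt (fun w => S (2 * w)) (T (2 * w) * 2) w := by
      have h0 : HasDerivAt (fun w : ℝ => 2 * w) 2 w := by
        simpa using (hasDerivAt_id w).const_mul 2
      exact (hSd (2 * w)).comp w h0
    have := (h1.log (hSpos _).ne').sub (((hSd w).log (hSpos _).ne').const_mul 2)
    exact this.congr_deriv (by ring)
  have hGm : MonotoneOn (fun w => Real.log (S (2 * w)) - 2 * Real.log (S w)) (Set.Ici 0) := by
    refine monotoneOn_of_deriv_nonneg (convex_Ici 0)
      (fun w _ => (hG w).continuousAt.continuousWithinAt)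
      (fun w _ => (hG w).differentiableAt.differentiableWithinAt) fun w hw => ?_
    rw [interior_Ici, Set.mem_Ioi] at hw
    rw [(hG w).deriv]
    have := tilted_mean_monotone hn t (show w ≤ 2 * w by linarith)
    simp only [] at this
    have : T w / S w ≤ T (2 * w) / S (2 * w) := this
    linarith
  have heq : ∀ w, ∑ i, (exp (w * t i) / ∑ j, exp (w * t j)) ^ 2
      = exp (Real.log (S (2 * w)) - 2 * Real.log (S w)) := by
    intro w
    rw [Real.exp_sub, Real.exp_log (hSpos _), two_mul (Real.log _), Real.exp_add,
      Real.exp_log (hSpos _)]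
    simp only [hS, div_pow, ← Finset.sum_div]
    congr 1
    · refine Finset.sum_congr rfl fun i _ => ?_
      rw [sq, ← Real.exp_add]; congr 1; ring
    · rw [sq]
  intro a ha b hb hab
  simp only [heq]
  exact exp_le_exp.2 (hGm ha hb hab)

end Monotonicity

section Bounds

variable {d n : ℕ}

/-- The softmax-averaged height of the context points above the query. -/
def attnHeight (q : EuclideanSpace ℝ (Fin d)) (w : ℝ) (x : Fin n → EuclideanSpace ℝ (Fin d)) : ℝ :=
  ∑ i, attnWeight (w • q) x i * (1 - ⟪x i, q⟫)

lemma continuous_attnHeight (hn : 0 < n) (q : EuclideanSpace ℝ (Fin d)) (w : ℝ) :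
    Continuous (attnHeight (n := n) q w) :=
  continuous_finsetSum Finset.univ fun i _ =>
    (continuous_attnWeight_right hn (w • q) i).mul (by fun_prop)

lemma continuous_sum_attnWeight_sq (hn : 0 < n) (u : EuclideanSpace ℝ (Fin d)) :
    Continuous fun x : Fin n → EuclideanSpace ℝ (Fin d) => ∑ i, attnWeight u x i ^ 2 :=
  continuous_finsetSum Finset.univ fun i _ => (continuous_attnWeight_right hn u i).pow 2

lemma attnHeight_eq_inner (hn : 0 < n) {q : EuclideanSpace ℝ (Fin d)} (hq : ‖q‖ = 1) (w : ℝ)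
    (x : Fin n → EuclideanSpace ℝ (Fin d)) :
    attnHeight q w x = ⟪q - attnMean (w • q) x, q⟫ := by
  rw [inner_sub_left, real_inner_self_eq_norm_sq, hq, attnMean, sum_inner]
  simp only [inner_smul_left, conj_trivial, attnHeight, mul_sub, Finset.sum_sub_distrib, mul_one,
    sum_attnWeight hn]
  norm_num

lemma attnHeight_antitone (hn : 0 < n) (q : EuclideanSpace ℝ (Fin d))
    (x : Fin n → EuclideanSpace ℝ (Fin d)) : Antitone fun w => attnHeight q w x := by
  intro w w' hw
  have h : ∀ w, attnHeight q w x = 1 - (∑ i, ⟪x i, q⟫ * exp (w * ⟪x i, q⟫)) /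
      ∑ i, exp (w * ⟪x i, q⟫) := by
    intro w
    simp only [attnHeight, mul_sub, Finset.sum_sub_distrib, mul_one, sum_attnWeight hn,
      Finset.sum_div]
    congr 1
    refine Finset.sum_congr rfl fun i _ => ?_
    simp only [attnWeight, inner_smul_right]
    ring
  have := tilted_mean_monotone hn (fun i => ⟪x i, q⟫) hw
  simp only [h] at *
  linarith

lemma sum_attnWeight_sq_monotoneOn (hn : 0 < n) (q : EuclideanSpace ℝ (Fin d))
    (x : Fin n → EuclideanSpace ℝ (Fin d)) :
    MonotoneOn (fun w : ℝ => ∑ i, attnWeight (w • q) x i ^ 2) (Set.Ici 0) := by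
  simpa only [attnWeight, inner_smul_right] using
    tilted_collision_monotoneOn hn fun i => ⟪x i, q⟫

lemma exp_neg_height_le_one {q x : EuclideanSpace ℝ (Fin d)} (hq : ‖q‖ = 1) (hx : ‖x‖ = 1)
    {w : ℝ} (hw : 0 ≤ w) : exp (-(w * (1 - ⟪x, q⟫))) ≤ 1 := by
  rw [exp_le_one_iff]
  have := mul_nonneg hw (height_nonneg hq hx)
  linarith

lemma heightMoment_nonneg {q : EuclideanSpace ℝ (Fin d)} (hq : ‖q‖ = 1) (w : ℝ) :
    0 ≤ heightMoment q w := by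
  refine integral_nonneg_of_ae ?_
  filter_upwards [ae_norm_eq_one_sphereUniform d] with x hx
  exact mul_nonneg (height_nonneg hq hx) (exp_pos _).le

lemma integral_attnHeight_ge (hd : 2 ≤ d) (hn : 0 < n) {q : EuclideanSpace ℝ (Fin d)}
    (hq : ‖q‖ = 1) {w : ℝ} (hw : 0 ≤ w) :
    n * heightMoment q w / (1 + n * heightLaplace q w)
      ≤ ∫ x, attnHeight (n := n) q w x ∂(sphereSample d n) := by
  set μ := heightLaplace q w with hμ
  set b := heightMoment q w with hb
  have hμ0 : 0 ≤ μ := heightLaplace_nonneg q w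
  have hb0 : 0 ≤ b := heightMoment_nonneg hq w
  set c := 1 + n * μ with hc
  have hc0 : 0 < c := by positivity
  have hn1 : (1 : ℝ) ≤ n := by exact_mod_cast hn
  let a : EuclideanSpace ℝ (Fin d) → ℝ := fun x => exp (-(w * (1 - ⟪x, q⟫)))
  let f : EuclideanSpace ℝ (Fin d) → ℝ := fun x => (1 - ⟪x, q⟫) * exp (-(w * (1 - ⟪x, q⟫)))
  have ha : Continuous a := by fun_prop
  have hf : Continuous f := by fun_prop
  have hpt : ∀ᵐ x ∂(sphereSample d n), 2 / c * (∑ i, f (x i)) - 1 / c ^ 2 *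
      ((∑ i, f (x i)) * ∑ i, a (x i)) ≤ attnHeight q w x := by
    filter_upwards [ae_norm_eq_one_sphereSample hd] with x hx
    have hF : 0 ≤ ∑ i, f (x i) := Finset.sum_nonneg fun i _ =>
      mul_nonneg (height_nonneg hq (hx i)) (exp_pos _).le
    have hS : 0 < ∑ i, a (x i) := sum_exp_pos hn _
    have h1 : attnHeight q w x = (∑ i, f (x i)) * (1 / ∑ i, a (x i)) := by
      simp only [attnHeight, attnWeight_smul, f, a]
      rw [Finset.sum_mul]
      refine Finset.sum_congr rfl fun i _ => ?_
      ring
    have h2 : 2 / c - 1 / c ^ 2 * (∑ i, a (x i)) ≤ 1 / ∑ i, a (x i) := by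
      rw [le_div_iff₀ hS]
      have : (2 / c - 1 / c ^ 2 * (∑ i, a (x i))) * (∑ i, a (x i))
          = 1 - (1 - (∑ i, a (x i)) / c) ^ 2 := by field_simp; ring
      rw [this]
      nlinarith [sq_nonneg (1 - (∑ i, a (x i)) / c)]
    rw [h1]
    calc _ = (∑ i, f (x i)) * (2 / c - 1 / c ^ 2 * (∑ i, a (x i))) := by ring
      _ ≤ _ := by gcongr
  have hint := integral_mono_ae (integrable_sphereSample hd (by fun_prop))
    (integrable_sphereSample hd (continuous_attnHeight hn q w)) hpt
  refine le_trans ?_ hint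
  rw [integral_sub (integrable_sphereSample hd (by fun_prop))
    (integrable_sphereSample hd (by fun_prop)), integral_const_mul, integral_const_mul,
    integral_sum_sphereSample hd hf, integral_sum_mul_sum_sphereSample hd hf ha]
  change _ ≤ 2 / c * (n * b) - 1 / c ^ 2 * (n * (∫ x, f x * a x ∂(sphereUniform d))
    + n * (n - 1) * (b * μ))
  have h3 : ∫ x, f x * a x ∂(sphereUniform d) ≤ b := by
    refine integral_mono_ae (integrable_sphereUniform hd (by fun_prop))
      (integrable_sphereUniform hd (by fun_prop)) ?_
    filter_upwards [ae_norm_eq_one_sphereUniform d] with x hx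
    exact mul_le_of_le_one_right (mul_nonneg (height_nonneg hq hx) (exp_pos _).le)
      (exp_neg_height_le_one hq hx hw)
  have h4 : n * (∫ x, f x * a x ∂(sphereUniform d)) + n * (n - 1) * (b * μ) ≤ n * b * c := by
    have : n * (∫ x, f x * a x ∂(sphereUniform d)) ≤ n * b := by gcongr
    have h5 : (n : ℝ) * (n - 1) * (b * μ) ≤ n * n * (b * μ) := by gcongr; linarith
    rw [hc]; linarith
  calc n * b / c = 2 / c * (n * b) - 1 / c ^ 2 * (n * b * c) := by field_simp; ring
    _ ≤ _ := by gcongr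

lemma integral_sum_attnWeight_sq_ge (hd : 2 ≤ d) (hn : 0 < n) {q : EuclideanSpace ℝ (Fin d)}
    (hq : ‖q‖ = 1) {w : ℝ} (hw : 0 ≤ w) :
    n * heightLaplace q (2 * w) / (1 + n * heightLaplace q w) ^ 2
      ≤ ∫ x, ∑ i : Fin n, attnWeight (w • q) x i ^ 2 ∂(sphereSample d n) := by
  set μ := heightLaplace q w with hμ
  set b := heightLaplace q (2 * w) with hb
  have hμ0 : 0 ≤ μ := heightLaplace_nonneg q w
  have hb0 : 0 ≤ b := heightLaplace_nonneg q _
  set c := 1 + n * μ with hc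
  have hc0 : 0 < c := by positivity
  have hn1 : (1 : ℝ) ≤ n := by exact_mod_cast hn
  let a : EuclideanSpace ℝ (Fin d) → ℝ := fun x => exp (-(w * (1 - ⟪x, q⟫)))
  let f : EuclideanSpace ℝ (Fin d) → ℝ := fun x => exp (-(2 * w * (1 - ⟪x, q⟫)))
  have ha : Continuous a := by fun_prop
  have hf : Continuous f := by fun_prop
  have hfa : ∀ x, f x = a x ^ 2 := by
    intro x; simp only [f, a]; rw [← Real.exp_nat_mul]; congr 1; push_cast; ring
  have hpt : ∀ x : Fin n → EuclideanSpace ℝ (Fin d), 3 / c ^ 2 * (∑ i, f (x i)) - 2 / c ^ 3 *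
      ((∑ i, f (x i)) * ∑ i, a (x i)) ≤ ∑ i, attnWeight (w • q) x i ^ 2 := by
    intro x
    have hF : 0 ≤ ∑ i, f (x i) := Finset.sum_nonneg fun i _ => (exp_pos _).le
    have hS : 0 < ∑ i, a (x i) := sum_exp_pos hn _
    have h1 : ∑ i, attnWeight (w • q) x i ^ 2 = (∑ i, f (x i)) * (1 / (∑ i, a (x i)) ^ 2) := by
      simp only [attnWeight_smul, hfa, div_pow]
      rw [Finset.sum_mul]
      refine Finset.sum_congr rfl fun i _ => ?_
      simp only [a]; ring
    have h2 : 3 / c ^ 2 - 2 / c ^ 3 * (∑ i, a (x i)) ≤ 1 / (∑ i, a (x i)) ^ 2 := by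
      rw [le_div_iff₀ (by positivity)]
      have : (3 / c ^ 2 - 2 / c ^ 3 * (∑ i, a (x i))) * (∑ i, a (x i)) ^ 2
          = 1 - (1 - (∑ i, a (x i)) / c) ^ 2 * (1 + 2 * ((∑ i, a (x i)) / c)) := by
        field_simp; ring
      rw [this]
      have : 0 ≤ (1 - (∑ i, a (x i)) / c) ^ 2 * (1 + 2 * ((∑ i, a (x i)) / c)) := by positivity
      linarith
    rw [h1]
    calc _ = (∑ i, f (x i)) * (3 / c ^ 2 - 2 / c ^ 3 * (∑ i, a (x i))) := by ring
      _ ≤ _ := by gcongr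
  have hint := integral_mono (integrable_sphereSample hd (by fun_prop))
    (integrable_sphereSample hd (continuous_sum_attnWeight_sq hn (w • q))) hpt
  refine le_trans ?_ hint
  rw [integral_sub (integrable_sphereSample hd (by fun_prop))
    (integrable_sphereSample hd (by fun_prop)), integral_const_mul, integral_const_mul,
    integral_sum_sphereSample hd hf, integral_sum_mul_sum_sphereSample hd hf ha]
  change _ ≤ 3 / c ^ 2 * (n * b) - 2 / c ^ 3 * (n * (∫ x, f x * a x ∂(sphereUniform d))
    + n * (n - 1) * (b * μ))
  have h3 : ∫ x, f x * a x ∂(sphereUniform d) ≤ b := by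
    refine integral_mono_ae (integrable_sphereUniform hd (by fun_prop))
      (integrable_sphereUniform hd (by fun_prop)) ?_
    filter_upwards [ae_norm_eq_one_sphereUniform d] with x hx
    exact mul_le_of_le_one_right (exp_pos _).le (exp_neg_height_le_one hq hx hw)
  have h4 : n * (∫ x, f x * a x ∂(sphereUniform d)) + n * (n - 1) * (b * μ) ≤ n * b * c := by
    have : n * (∫ x, f x * a x ∂(sphereUniform d)) ≤ n * b := by gcongr
    have h5 : (n : ℝ) * (n - 1) * (b * μ) ≤ n * n * (b * μ) := by gcongr; linarith
    rw [hc]; linarith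
  calc n * b / c ^ 2 = 3 / c ^ 2 * (n * b) - 2 / c ^ 3 * (n * b * c) := by field_simp; ring
    _ ≤ _ := by gcongr

lemma exp_neg_le_one_sub_half {a : ℝ} (h0 : 0 ≤ a) (h1 : a ≤ 1) : exp (-a) ≤ 1 - a / 2 := by
  rw [Real.exp_neg, inv_le_comm₀ (exp_pos _) (by linarith)]
  have h2 : (1 - a / 2)⁻¹ ≤ 1 + a := by
    rw [inv_le_comm₀ (by linarith) (by linarith), inv_eq_one_div, div_le_iff₀ (by linarith)]
    nlinarith
  linarith [Real.add_one_le_exp a]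

lemma integral_exp_neg_sum_le (hd : 2 ≤ d) {q : EuclideanSpace ℝ (Fin d)}
    (hq : ‖q‖ = 1) {w : ℝ} (hw : 0 ≤ w) :
    ∫ x : Fin n → EuclideanSpace ℝ (Fin d), exp (-∑ i, exp (-(w * (1 - ⟪x i, q⟫))))
      ∂(sphereSample d n) ≤ exp (-(n * heightLaplace q w / 2)) := by
  have := isProbabilityMeasure_sphereUniform hd
  have h1 : ∫ x : Fin n → EuclideanSpace ℝ (Fin d), exp (-∑ i, exp (-(w * (1 - ⟪x i, q⟫))))
      ∂(sphereSample d n) = (∫ x, exp (-exp (-(w * (1 - ⟪x, q⟫)))) ∂(sphereUniform d)) ^ n := by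
    have := integral_fintype_prod_eq_pow (ι := Fin n) (𝕜 := ℝ) (μ := sphereUniform d)
      fun x => exp (-exp (-(w * (1 - ⟪x, q⟫))))
    rw [Fintype.card_fin] at this
    rw [← this, sphereSample]
    congr 1; ext x
    rw [← Finset.sum_neg_distrib, Real.exp_sum]
  have h2 : ∫ x, exp (-exp (-(w * (1 - ⟪x, q⟫)))) ∂(sphereUniform d)
      ≤ 1 - heightLaplace q w / 2 := by
    have h3 : ∫ x, exp (-exp (-(w * (1 - ⟪x, q⟫)))) ∂(sphereUniform d)
        ≤ ∫ x, (1 - exp (-(w * (1 - ⟪x, q⟫))) / 2) ∂(sphereUniform d) := by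
      refine integral_mono_ae (integrable_sphereUniform hd (by fun_prop))
        (integrable_sphereUniform hd (by fun_prop)) ?_
      filter_upwards [ae_norm_eq_one_sphereUniform d] with x hx
      exact exp_neg_le_one_sub_half (exp_pos _).le (exp_neg_height_le_one hq hx hw)
    refine h3.trans_eq ?_
    rw [integral_sub (integrable_const _) (integrable_sphereUniform hd (by fun_prop)),
      integral_div]
    simp [heightLaplace]
  rw [h1]
  calc _ ≤ (exp (-(heightLaplace q w / 2))) ^ n := by
        refine pow_le_pow_left₀ (integral_nonneg fun x => (exp_pos _).le) (h2.trans ?_) n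
        have := Real.add_one_le_exp (-(heightLaplace q w / 2))
        linarith
    _ = _ := by rw [← Real.exp_nat_mul]; congr 1; ring

lemma exp_neg_quarter_le {y : ℝ} (hy : 0 < y) : exp (-(y / 4)) ≤ 4 / y := by
  rw [Real.exp_neg, inv_le_comm₀ (exp_pos _) (by positivity), inv_div]
  linarith [Real.add_one_le_exp (y / 4)]

lemma integral_sum_attnWeight_sq_le (hd : 2 ≤ d) (hn : 0 < n) {q : EuclideanSpace ℝ (Fin d)}
    (hq : ‖q‖ = 1) {w : ℝ} (hw : 0 ≤ w) (hμ : 0 < heightLaplace q w) :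
    ∫ x, ∑ i : Fin n, attnWeight (w • q) x i ^ 2 ∂(sphereSample d n)
      ≤ 20 / (n * heightLaplace q w) := by
  set μ := heightLaplace q w with hμdef
  have hn0 : (0 : ℝ) < n := by exact_mod_cast hn
  set y := n * μ with hy
  have hy0 : 0 < y := by positivity
  let a : EuclideanSpace ℝ (Fin d) → ℝ := fun x => exp (-(w * (1 - ⟪x, q⟫)))
  have ha : Continuous a := by fun_prop
  have hpt : ∀ᵐ x ∂(sphereSample d n), ∑ i, attnWeight (w • q) x i ^ 2
      ≤ 16 / y ^ 2 * (∑ i, a (x i)) + exp (y / 4) * exp (-∑ i, a (x i)) := by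
    filter_upwards [ae_norm_eq_one_sphereSample hd] with x hx
    have hS : 0 < ∑ i, a (x i) := sum_exp_pos hn _
    rcases le_total (y / 4) (∑ i, a (x i)) with h | h
    · have h1 : ∑ i, attnWeight (w • q) x i ^ 2 = (∑ i, a (x i) ^ 2) / (∑ i, a (x i)) ^ 2 := by
        simp only [attnWeight_smul, div_pow, ← Finset.sum_div]; rfl
      have h2 : ∑ i, a (x i) ^ 2 ≤ ∑ i, a (x i) := by
        refine Finset.sum_le_sum fun i _ => ?_
        have h3 : a (x i) ≤ 1 := exp_neg_height_le_one hq (hx i) hw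
        have h4 : 0 ≤ a (x i) := (exp_pos _).le
        nlinarith
      have h5 : (∑ i, a (x i) ^ 2) / (∑ i, a (x i)) ^ 2 ≤ (∑ i, a (x i)) / (y / 4) ^ 2 := by
        gcongr
      rw [h1]
      refine h5.trans ?_
      have h6 : 0 < exp (y / 4) * exp (-∑ i, a (x i)) := by positivity
      have h7 : (∑ i, a (x i)) / (y / 4) ^ 2 = 16 / y ^ 2 * (∑ i, a (x i)) := by
        field_simp; norm_num
      linarith
    · have h1 : ∑ i, attnWeight (w • q) x i ^ 2 ≤ 1 := by
        rw [← sum_attnWeight hn (w • q) x]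
        refine Finset.sum_le_sum fun i _ => ?_
        have h2 := attnWeight_pos hn (w • q) x i
        have h3 : attnWeight (w • q) x i ≤ 1 := by
          rw [← sum_attnWeight hn (w • q) x]
          exact Finset.single_le_sum (fun j _ => (attnWeight_pos hn (w • q) x j).le)
            (Finset.mem_univ i)
        nlinarith
      have h2 : 1 ≤ exp (y / 4) * exp (-∑ i, a (x i)) := by
        rw [← Real.exp_add, Real.one_le_exp_iff]; linarith
      have h3 : 0 ≤ 16 / y ^ 2 * (∑ i, a (x i)) := by positivity
      linarith
  refine (integral_mono_ae (integrable_sphereSample hd (continuous_sum_attnWeight_sq hn (w • q)))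
    (integrable_sphereSample hd (by fun_prop)) hpt).trans ?_
  rw [integral_add (integrable_sphereSample hd (by fun_prop))
    (integrable_sphereSample hd (by fun_prop)), integral_const_mul, integral_const_mul,
    integral_sum_sphereSample hd ha]
  have h1 : 16 / y ^ 2 * (n * ∫ x, a x ∂(sphereUniform d)) = 16 / y := by
    change 16 / y ^ 2 * y = _
    field_simp
  have h2 := integral_exp_neg_sum_le (n := n) hd hq hw
  have h3 : exp (y / 4) * (∫ x : Fin n → EuclideanSpace ℝ (Fin d), exp (-∑ i, a (x i))
      ∂(sphereSample d n)) ≤ 4 / y := by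
    calc _ ≤ exp (y / 4) * exp (-(y / 2)) := by gcongr
      _ = exp (-(y / 4)) := by rw [← Real.exp_add]; congr 1; ring
      _ ≤ 4 / y := exp_neg_quarter_le hy0
  rw [h1]
  have : 20 / y = 16 / y + 4 / y := by ring
  linarith

end Bounds

section Bias

variable {d n : ℕ}

/-- The reflection along `z` negates `z` and fixes the vectors orthogonal to `z`. -/
lemma exists_reflection (z : EuclideanSpace ℝ (Fin d)) :
    ∃ R : EuclideanSpace ℝ (Fin d) ≃ₗᵢ[ℝ] EuclideanSpace ℝ (Fin d),
      R z = -z ∧ ∀ y, ⟪y, z⟫ = 0 → R y = y := by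
  refine ⟨(ℝ ∙ z)ᗮ.reflection, Submodule.reflection_orthogonalComplement_singleton_eq_neg z,
    fun y hy => ?_⟩
  refine Submodule.reflection_mem_subspace_eq_self ?_
  rw [Submodule.mem_orthogonal_singleton_iff_inner_left]
  exact hy

lemma attnMean_sub (hn : 0 < n) (u q : EuclideanSpace ℝ (Fin d))
    (x : Fin n → EuclideanSpace ℝ (Fin d)) :
    attnMean u x - q = ∑ i, attnWeight u x i • (x i - q) := by
  simp only [smul_sub, Finset.sum_sub_distrib, ← Finset.sum_smul, sum_attnWeight hn, one_smul,
    attnMean]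

lemma norm_attnMean_le (hn : 0 < n) (u : EuclideanSpace ℝ (Fin d))
    {x : Fin n → EuclideanSpace ℝ (Fin d)} (hx : ∀ i, ‖x i‖ = 1) : ‖attnMean u x‖ ≤ 1 := by
  refine (norm_sum_le _ _).trans ?_
  rw [← sum_attnWeight hn u x]
  refine Finset.sum_le_sum fun i _ => ?_
  rw [norm_smul, hx i, mul_one, Real.norm_of_nonneg (attnWeight_pos hn u x i).le]

lemma continuous_norm_attnMean_sub_sq (hn : 0 < n) (u q : EuclideanSpace ℝ (Fin d)) :
    Continuous fun x : Fin n → EuclideanSpace ℝ (Fin d) => ‖attnMean u x - q‖ ^ 2 :=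
  (((continuous_attnMean_right hn u).sub continuous_const).norm).pow 2

lemma sq_integral_attnHeight_le (hd : 2 ≤ d) (hn : 0 < n) {q : EuclideanSpace ℝ (Fin d)}
    (hq : ‖q‖ = 1) (w : ℝ) :
    (∫ x, attnHeight (n := n) q w x ∂(sphereSample d n)) ^ 2
      ≤ ∫ x, ‖attnMean (n := n) (w • q) x - q‖ ^ 2 ∂(sphereSample d n) := by
  have := isProbabilityMeasure_sphereSample (n := n) hd
  set c := ∫ x, attnHeight (n := n) q w x ∂(sphereSample d n) with hc
  have hi := integrable_sphereSample (d := d) hd (continuous_attnHeight (n := n) hn q w)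
  have h : ∫ x, (2 * c * attnHeight (n := n) q w x - c ^ 2) ∂(sphereSample d n)
      ≤ ∫ x, ‖attnMean (n := n) (w • q) x - q‖ ^ 2 ∂(sphereSample d n) := by
    refine integral_mono ((hi.const_mul _).sub (integrable_const _))
      (integrable_sphereSample hd (continuous_norm_attnMean_sub_sq hn _ _)) fun x => ?_
    have h1 : |attnHeight q w x| ≤ ‖attnMean (w • q) x - q‖ := by
      rw [attnHeight_eq_inner hn hq, norm_sub_rev]
      simpa [hq] using abs_real_inner_le_norm (q - attnMean (w • q) x) q
    have h2 : attnHeight q w x ^ 2 ≤ ‖attnMean (w • q) x - q‖ ^ 2 := sq_le_sq' (by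
      linarith [neg_abs_le (attnHeight q w x)]) ((le_abs_self _).trans h1)
    simp only []
    nlinarith [sq_nonneg (attnHeight q w x - c)]
  rw [integral_sub (hi.const_mul _) (integrable_const _), integral_const_mul, ← hc] at h
  simp at h
  nlinarith

/-- By symmetry the tilted mean displacement is parallel to the query. -/
lemma integral_exp_mul_inner_sub (hd : 2 ≤ d) {q : EuclideanSpace ℝ (Fin d)}
    (hq : ‖q‖ = 1) (w : ℝ) (z : EuclideanSpace ℝ (Fin d)) :
    ∫ x, exp (-(w * (1 - ⟪x, q⟫))) * ⟪x - q, z⟫ ∂(sphereUniform d)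
      = -(heightMoment q w * ⟪q, z⟫) := by
  set z' := z - ⟪q, z⟫ • q with hz'
  have hqz : ⟪q, z'⟫ = 0 := by
    rw [hz', inner_sub_right, inner_smul_right, real_inner_self_eq_norm_sq, hq]; ring
  obtain ⟨R, hRz, hR⟩ := exists_reflection z'
  have hRq := hR q hqz
  let f : EuclideanSpace ℝ (Fin d) → ℝ := fun x => exp (-(w * (1 - ⟪x, q⟫))) * ⟪x, z'⟫
  have hf : Continuous f := by fun_prop
  have hfR : ∀ x, f (R x) = - f x := by
    intro x
    have h1 : ⟪R x, q⟫ = ⟪x, q⟫ := by conv_lhs => rw [← hRq, R.inner_map_map]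
    have h2 : ⟪R x, z'⟫ = -⟪x, z'⟫ := by
      have : ⟪R x, R z'⟫ = ⟪x, z'⟫ := R.inner_map_map x z'
      rw [hRz, inner_neg_right] at this; linarith
    simp only [f, h1, h2]; ring
  have h0 : ∫ x, f x ∂(sphereUniform d) = 0 := by
    have h1 := (measurePreserving_sphereUniform R).integral_comp'
      (f := R.toHomeomorph.toMeasurableEquiv) f
    have h2 : ∫ x, f (R x) ∂(sphereUniform d) = ∫ x, f x ∂(sphereUniform d) := h1
    simp only [hfR, integral_neg] at h2
    linarith
  have hsplit : ∀ x, exp (-(w * (1 - ⟪x, q⟫))) * ⟪x - q, z⟫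
      = f x - ⟪q, z⟫ * ((1 - ⟪x, q⟫) * exp (-(w * (1 - ⟪x, q⟫)))) := by
    intro x
    simp only [f, hz', inner_sub_left, inner_sub_right, inner_smul_right]
    ring
  simp only [hsplit]
  rw [integral_sub (integrable_sphereUniform hd hf) (integrable_sphereUniform hd (by fun_prop)),
    integral_const_mul, h0, heightMoment]
  ring

lemma integral_norm_sum_displacement_sq_le (hd : 2 ≤ d) {q : EuclideanSpace ℝ (Fin d)}
    (hq : ‖q‖ = 1) {w : ℝ} (hw : 0 ≤ w) :
    ∫ x : Fin n → EuclideanSpace ℝ (Fin d),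
        ‖∑ i, exp (-(w * (1 - ⟪x i, q⟫))) • (x i - q)‖ ^ 2 ∂(sphereSample d n)
      ≤ 2 * (n * heightMoment q w) + (n * heightMoment q w) ^ 2 := by
  let F : EuclideanSpace ℝ (Fin d) → EuclideanSpace ℝ (Fin d) :=
    fun x => exp (-(w * (1 - ⟪x, q⟫))) • (x - q)
  have hF : Continuous F := by fun_prop
  have hFk : ∀ k, Continuous fun x => F x k := fun k => by fun_prop
  have h1 : ∀ x : Fin n → EuclideanSpace ℝ (Fin d),
      ‖∑ i, exp (-(w * (1 - ⟪x i, q⟫))) • (x i - q)‖ ^ 2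
        = ∑ k, (∑ i, F (x i) k) * (∑ i, F (x i) k) := by
    intro x
    rw [EuclideanSpace.real_norm_sq_eq]
    refine Finset.sum_congr rfl fun k _ => ?_
    rw [WithLp.ofLp_sum, Finset.sum_apply, sq]
  simp only [h1]
  rw [integral_finsetSum _ fun k _ => integrable_sphereSample hd (by fun_prop)]
  have hk : ∀ k, ∫ x, F x k ∂(sphereUniform d) = -(heightMoment q w * q k) := by
    intro k
    have := integral_exp_mul_inner_sub hd hq w (EuclideanSpace.single k 1)
    simpa [EuclideanSpace.inner_single_right, F] using this
  simp only [integral_sum_mul_sum_sphereSample hd (hFk _) (hFk _), hk]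
  rw [Finset.sum_add_distrib, ← Finset.mul_sum, ← Finset.mul_sum,
    ← integral_finsetSum _ fun k _ => integrable_sphereUniform hd (by fun_prop)]
  have h2 : ∫ x, ∑ k, F x k * F x k ∂(sphereUniform d) ≤ 2 * heightMoment q w := by
    rw [heightMoment, ← integral_const_mul]
    refine integral_mono_ae (integrable_sphereUniform hd (by fun_prop))
      (integrable_sphereUniform hd (by fun_prop)) ?_
    filter_upwards [ae_norm_eq_one_sphereUniform d] with x hx
    have h3 : ∑ k, F x k * F x k = ‖F x‖ ^ 2 := by
      rw [EuclideanSpace.real_norm_sq_eq]; simp only [sq]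
    have h4 : ‖x - q‖ ^ 2 = 2 * (1 - ⟪x, q⟫) := by
      rw [norm_sub_sq_real, hx, hq]; ring
    have h5 := exp_neg_height_le_one hq hx hw
    have h6 := height_nonneg hq hx
    have h7 : 0 < exp (-(w * (1 - ⟪x, q⟫))) := exp_pos _
    rw [h3, norm_smul, mul_pow, h4, Real.norm_of_nonneg h7.le]
    have : exp (-(w * (1 - ⟪x, q⟫))) ^ 2 ≤ exp (-(w * (1 - ⟪x, q⟫))) := by nlinarith
    nlinarith
  have h8 : ∑ k, -(heightMoment q w * q k) * -(heightMoment q w * q k) = heightMoment q w ^ 2 := by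
    have : ∑ k, q k ^ 2 = 1 := by rw [← EuclideanSpace.real_norm_sq_eq, hq]; norm_num
    calc _ = heightMoment q w ^ 2 * ∑ k, q k ^ 2 := by
          rw [Finset.mul_sum]; exact Finset.sum_congr rfl fun k _ => by ring
      _ = _ := by rw [this, mul_one]
  rw [h8]
  have hn : (0 : ℝ) ≤ n := n.cast_nonneg
  nlinarith [mul_le_mul_of_nonneg_left h2 hn, sq_nonneg (heightMoment q w)]

lemma integral_norm_attnMean_sub_sq_le (hd : 2 ≤ d) (hn : 0 < n) {q : EuclideanSpace ℝ (Fin d)}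
    (hq : ‖q‖ = 1) {w : ℝ} (hw : 0 ≤ w) (hμ : 0 < heightLaplace q w) :
    ∫ x, ‖attnMean (n := n) (w • q) x - q‖ ^ 2 ∂(sphereSample d n)
      ≤ 16 / (n * heightLaplace q w) ^ 2 *
          (2 * (n * heightMoment q w) + (n * heightMoment q w) ^ 2)
        + 4 * exp (-(n * heightLaplace q w / 4)) := by
  have hn0 : (0 : ℝ) < n := by exact_mod_cast hn
  set y := n * heightLaplace q w with hy
  have hy0 : 0 < y := by positivity
  let a : EuclideanSpace ℝ (Fin d) → ℝ := fun x => exp (-(w * (1 - ⟪x, q⟫)))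
  have ha : Continuous a := by fun_prop
  have hpt : ∀ᵐ x ∂(sphereSample d n), ‖attnMean (n := n) (w • q) x - q‖ ^ 2
      ≤ 16 / y ^ 2 * ‖∑ i, a (x i) • (x i - q)‖ ^ 2
        + 4 * exp (y / 4) * exp (-∑ i, a (x i)) := by
    filter_upwards [ae_norm_eq_one_sphereSample hd] with x hx
    have hS : 0 < ∑ i, a (x i) := sum_exp_pos hn _
    rcases le_total (y / 4) (∑ i, a (x i)) with h | h
    · have h1 : attnMean (w • q) x - q = (∑ i, a (x i))⁻¹ • ∑ i, a (x i) • (x i - q) := by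
        rw [attnMean_sub hn, Finset.smul_sum]
        refine Finset.sum_congr rfl fun i _ => ?_
        rw [attnWeight_smul, smul_smul, div_eq_inv_mul]
      rw [h1, norm_smul, mul_pow, Real.norm_of_nonneg (inv_nonneg.2 hS.le)]
      have h5 : (∑ i, a (x i))⁻¹ ^ 2 ≤ 16 / y ^ 2 := by
        calc (∑ i, a (x i))⁻¹ ^ 2 ≤ (y / 4)⁻¹ ^ 2 := by gcongr
          _ = _ := by rw [inv_div, div_pow]; norm_num
      have h6 : 0 < 4 * exp (y / 4) * exp (-∑ i, a (x i)) := by positivity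
      have h7 := mul_le_mul_of_nonneg_right h5 (sq_nonneg ‖∑ i, a (x i) • (x i - q)‖)
      linarith
    · have h1 : ‖attnMean (w • q) x - q‖ ≤ 2 := by
        have := norm_attnMean_le hn (w • q) hx
        refine (norm_sub_le _ _).trans ?_
        rw [hq]; linarith
      have h2 : 1 ≤ exp (y / 4) * exp (-∑ i, a (x i)) := by
        rw [← Real.exp_add, Real.one_le_exp_iff]; linarith
      have h3 : 0 ≤ 16 / y ^ 2 * ‖∑ i, a (x i) • (x i - q)‖ ^ 2 := by positivity
      nlinarith [norm_nonneg (attnMean (w • q) x - q)]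
  have hc1 : Continuous fun x : Fin n → EuclideanSpace ℝ (Fin d) =>
      ‖∑ i, a (x i) • (x i - q)‖ ^ 2 := by fun_prop
  have hc2 : Continuous fun x : Fin n → EuclideanSpace ℝ (Fin d) =>
      exp (-∑ i, a (x i)) := by fun_prop
  have hi1 := (integrable_sphereSample hd hc1).const_mul (16 / y ^ 2)
  have hi2 := (integrable_sphereSample hd hc2).const_mul (4 * exp (y / 4))
  refine (integral_mono_ae (integrable_sphereSample hd (continuous_norm_attnMean_sub_sq hn _ _))
    (hi1.add hi2) hpt).trans ?_
  rw [integral_add' hi1 hi2, integral_const_mul, integral_const_mul]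
  have h1 := integral_norm_sum_displacement_sq_le (n := n) hd hq hw
  have h2 := integral_exp_neg_sum_le (n := n) hd hq hw
  refine add_le_add (mul_le_mul_of_nonneg_left h1 (by positivity)) ?_
  calc _ ≤ 4 * exp (y / 4) * exp (-(y / 2)) := by gcongr
    _ = 4 * exp (-(y / 4)) := by rw [mul_assoc, ← Real.exp_add]; congr 2; ring

end Bias

section Risk

variable {d n : ℕ}

/-- The risk of softmax attention at the query `q` when `q` is mapped to `u`: a multiple `s` of the
squared bias plus a multiple `t` of the expected collision probability of the weights. -/
def attnRisk (n : ℕ) (s t : ℝ) (u q : EuclideanSpace ℝ (Fin d)) : ℝ :=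
  s * (∫ x, ‖attnMean (n := n) u x - q‖ ^ 2 ∂(sphereSample d n)) +
    t * ∫ x, ∑ i : Fin n, attnWeight u x i ^ 2 ∂(sphereSample d n)

lemma attnRisk_map (hd : 2 ≤ d) (hn : 0 < n) (s t : ℝ)
    (R : EuclideanSpace ℝ (Fin d) ≃ₗᵢ[ℝ] EuclideanSpace ℝ (Fin d))
    (u q : EuclideanSpace ℝ (Fin d)) : attnRisk n s t (R u) (R q) = attnRisk n s t u q := by
  unfold attnRisk
  rw [← integral_sphereSample_map hd R (continuous_norm_attnMean_sub_sq hn (R u) (R q)),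
    ← integral_sphereSample_map hd R (continuous_sum_attnWeight_sq hn (R u))]
  simp only [attnMean_map, attnWeight_map, ← map_sub, LinearIsometryEquiv.norm_map]

lemma attnRisk_smul_self_eq (hd : 2 ≤ d) (hn : 0 < n) (s t w : ℝ)
    {q q' : EuclideanSpace ℝ (Fin d)} (h : ‖q‖ = ‖q'‖) :
    attnRisk n s t (w • q) q = attnRisk n s t (w • q') q' := by
  rw [← attnRisk_map hd hn s t (ℝ ∙ (q - q'))ᗮ.reflection (w • q) q, map_smul,
    Submodule.reflection_sub h]

lemma continuous_inner_attnMean (hn : 0 < n) (u z : EuclideanSpace ℝ (Fin d)) :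
    Continuous fun x : Fin n → EuclideanSpace ℝ (Fin d) => ⟪attnMean u x, z⟫ :=
  (continuous_attnMean_right hn u).inner continuous_const

lemma integral_inner_attnMean_eq_zero (hd : 2 ≤ d) (hn : 0 < n) {u z : EuclideanSpace ℝ (Fin d)}
    (h : ⟪u, z⟫ = 0) : ∫ x, ⟪attnMean (n := n) u x, z⟫ ∂(sphereSample d n) = 0 := by
  obtain ⟨R, hRz, hR⟩ := exists_reflection z
  have hRu := hR u h
  have h1 := integral_sphereSample_map hd R (continuous_inner_attnMean (n := n) hn u z)
  have h2 : ∀ x : Fin n → EuclideanSpace ℝ (Fin d),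
      ⟪attnMean u fun j => R (x j), z⟫ = -⟪attnMean u x, z⟫ := by
    intro x
    have h3 := attnMean_map R u x
    rw [hRu] at h3
    have h4 : ⟪R (attnMean u x), R z⟫ = ⟪attnMean u x, z⟫ := R.inner_map_map _ _
    rw [hRz, inner_neg_right] at h4
    rw [h3]; linarith
  simp only [h2, integral_neg] at h1
  linarith

lemma integral_norm_attnMean_sub_sq_eq (hd : 2 ≤ d) (hn : 0 < n) (r : ℝ)
    {v q : EuclideanSpace ℝ (Fin d)} (hv : ‖v‖ = 1) (hq : ‖q‖ = 1) :
    ∫ x, ‖attnMean (n := n) (r • v) x - q‖ ^ 2 ∂(sphereSample d n)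
      = (∫ x, ‖attnMean (n := n) (r • v) x‖ ^ 2 ∂(sphereSample d n)) + 1
        - 2 * ⟪v, q⟫ * ∫ x, ⟪attnMean (n := n) (r • v) x, v⟫ ∂(sphereSample d n) := by
  have := isProbabilityMeasure_sphereSample (n := n) hd
  set z := q - ⟪v, q⟫ • v with hz
  have hz0 : ⟪r • v, z⟫ = 0 := by
    rw [hz, inner_smul_left, inner_sub_right, inner_smul_right, real_inner_self_eq_norm_sq, hv]
    simp
  have h0 := integral_inner_attnMean_eq_zero (n := n) hd hn hz0
  have h1 : ∀ x : Fin n → EuclideanSpace ℝ (Fin d), ‖attnMean (r • v) x - q‖ ^ 2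
      = (‖attnMean (r • v) x‖ ^ 2 + 1)
        - (2 * ⟪v, q⟫ * ⟪attnMean (r • v) x, v⟫ + 2 * ⟪attnMean (r • v) x, z⟫) := by
    intro x
    rw [norm_sub_sq_real, hq, hz, inner_sub_right, inner_smul_right]
    ring
  have hi1 : Integrable (fun x => ‖attnMean (n := n) (r • v) x‖ ^ 2) (sphereSample d n) :=
    integrable_sphereSample hd ((continuous_attnMean_right hn (r • v)).norm.pow 2)
  have hi2 := fun z' => integrable_sphereSample hd (continuous_inner_attnMean (n := n) hn (r • v) z')
  have hi3 : Integrable (fun x => ‖attnMean (n := n) (r • v) x‖ ^ 2 + 1) (sphereSample d n) :=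
    hi1.add (integrable_const _)
  have hi4 : Integrable (fun x => 2 * ⟪v, q⟫ * ⟪attnMean (n := n) (r • v) x, v⟫
      + 2 * ⟪attnMean (n := n) (r • v) x, z⟫) (sphereSample d n) :=
    ((hi2 v).const_mul _).add ((hi2 z).const_mul _)
  simp only [h1]
  rw [integral_sub hi3 hi4, integral_add hi1 (integrable_const _),
    integral_add ((hi2 v).const_mul _) ((hi2 z).const_mul _), integral_const_mul,
    integral_const_mul, h0]
  simp

/-- The risk is the convex combination of the risks at the two queries parallel to `u`. -/
lemma attnRisk_eq_convex_combination (hd : 2 ≤ d) (hn : 0 < n) (s t r : ℝ)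
    {v q : EuclideanSpace ℝ (Fin d)} (hv : ‖v‖ = 1) (hq : ‖q‖ = 1) :
    attnRisk n s t (r • v) q = (1 + ⟪v, q⟫) / 2 * attnRisk n s t (r • q) q
      + (1 - ⟪v, q⟫) / 2 * attnRisk n s t ((-r) • q) q := by
  rw [attnRisk_smul_self_eq hd hn s t r (hq.trans hv.symm),
    attnRisk_smul_self_eq hd hn s t (-r) (show ‖q‖ = ‖-v‖ by rw [norm_neg, hq, hv]),
    neg_smul_neg]
  simp only [attnRisk, integral_norm_attnMean_sub_sq_eq hd hn r hv hq,
    integral_norm_attnMean_sub_sq_eq hd hn r hv hv,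
    integral_norm_attnMean_sub_sq_eq hd hn r hv (show ‖-v‖ = 1 by rw [norm_neg, hv]),
    inner_neg_right, real_inner_self_eq_norm_sq, hv]
  ring

lemma le_attnRisk_add_attnRisk_neg (hd : 2 ≤ d) (hn : 0 < n) {s t : ℝ} (hs : 0 ≤ s) (ht : 0 ≤ t)
    (r : ℝ) {q : EuclideanSpace ℝ (Fin d)} (hq : ‖q‖ = 1) :
    2 * s ≤ attnRisk n s t (r • q) q + attnRisk n s t ((-r) • q) q := by
  rw [attnRisk_smul_self_eq hd hn s t (-r) (show ‖q‖ = ‖-q‖ by rw [norm_neg]), neg_smul_neg]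
  simp only [attnRisk, integral_norm_attnMean_sub_sq_eq hd hn r hq hq,
    integral_norm_attnMean_sub_sq_eq hd hn r hq (show ‖-q‖ = 1 by rw [norm_neg, hq]),
    inner_neg_right, real_inner_self_eq_norm_sq, hq]
  have h1 : 0 ≤ ∫ x, ‖attnMean (n := n) (r • q) x‖ ^ 2 ∂(sphereSample d n) :=
    integral_nonneg fun x => sq_nonneg _
  have h2 : 0 ≤ ∫ x, ∑ i : Fin n, attnWeight (r • q) x i ^ 2 ∂(sphereSample d n) :=
    integral_nonneg fun x => Finset.sum_nonneg fun i _ => sq_nonneg _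
  nlinarith [mul_nonneg hs h1, mul_nonneg ht h2]

lemma exists_eq_smul_unit (hd : 2 ≤ d) (u : EuclideanSpace ℝ (Fin d)) :
    ∃ (r : ℝ) (v : EuclideanSpace ℝ (Fin d)), ‖v‖ = 1 ∧ u = r • v := by
  rcases eq_or_ne u 0 with rfl | h
  · obtain ⟨v, hv⟩ := exists_unit_vector hd
    exact ⟨0, v, hv, by simp⟩
  · have h' : ‖u‖ ≠ 0 := norm_ne_zero_iff.2 h
    exact ⟨‖u‖, ‖u‖⁻¹ • u, by rw [norm_smul, norm_inv, norm_norm, inv_mul_cancel₀ h'],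
      by rw [smul_smul, mul_inv_cancel₀ h', one_smul]⟩

lemma le_attnRisk (hd : 2 ≤ d) (hn : 0 < n) {s t m : ℝ} {q : EuclideanSpace ℝ (Fin d)}
    (hq : ‖q‖ = 1) (hm : ∀ w : ℝ, m ≤ attnRisk n s t (w • q) q)
    (u : EuclideanSpace ℝ (Fin d)) : m ≤ attnRisk n s t u q := by
  obtain ⟨r, v, hv, rfl⟩ := exists_eq_smul_unit hd u
  rw [attnRisk_eq_convex_combination hd hn s t r hv hq]
  have h := abs_le.1 (abs_real_inner_le_norm v q)
  rw [hv, hq, mul_one] at h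
  nlinarith [hm r, hm (-r)]

lemma eq_smul_of_attnRisk_le (hd : 2 ≤ d) (hn : 0 < n) {s t m : ℝ} (hs : 0 ≤ s) (ht : 0 ≤ t)
    (hms : m < s) {q : EuclideanSpace ℝ (Fin d)} (hq : ‖q‖ = 1)
    (hm : ∀ w : ℝ, m ≤ attnRisk n s t (w • q) q)
    {u : EuclideanSpace ℝ (Fin d)} (hu : attnRisk n s t u q ≤ m) : ∃ w : ℝ, u = w • q := by
  obtain ⟨r, v, hv, rfl⟩ := exists_eq_smul_unit hd u
  rw [attnRisk_eq_convex_combination hd hn s t r hv hq] at hu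
  have h := abs_le.1 (abs_real_inner_le_norm v q)
  rw [hv, hq, mul_one] at h
  have h2 := le_attnRisk_add_attnRisk_neg hd hn hs ht r hq
  have h3 := hm r
  have h4 := hm (-r)
  rcases h.1.eq_or_lt with h5 | h5
  · have : v = -q := by
      have : ‖v + q‖ ^ 2 = 0 := by rw [norm_add_sq_real, hv, hq, ← h5]; norm_num
      rw [sq_eq_zero_iff, norm_eq_zero] at this
      exact eq_neg_of_add_eq_zero_left this
    exact ⟨-r, by rw [this]; simp⟩
  rcases h.2.eq_or_lt with h6 | h6
  · have : v = q := by
      have : ‖v - q‖ ^ 2 = 0 := by rw [norm_sub_sq_real, hv, hq, h6]; norm_num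
      rw [sq_eq_zero_iff, norm_eq_zero, sub_eq_zero] at this
      exact this
    exact ⟨r, by rw [this]⟩
  exfalso
  have h7 : attnRisk n s t (r • q) q ≤ m := by nlinarith
  have h8 : attnRisk n s t ((-r) • q) q ≤ m := by nlinarith
  linarith

/-- A continuous function vanishing almost everywhere on the sphere vanishes on the sphere. -/
lemma eq_zero_of_ae_sphereUniform (hd : 2 ≤ d) {F : Type*} [NormedAddCommGroup F]
    {G : EuclideanSpace ℝ (Fin d) → F} (hG : Continuous G)
    (h : ∀ᵐ q ∂(sphereUniform d), G q = 0) {q : EuclideanSpace ℝ (Fin d)} (hq : ‖q‖ = 1) :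
    G q = 0 := by
  by_contra hne
  obtain ⟨c, C, hc, -, hcap⟩ := exists_sphereUniform_cap_bounds hd
  have hopen : IsOpen {x | G x ≠ 0} := isOpen_ne_fun hG continuous_const
  obtain ⟨ε, hε, hball⟩ := Metric.isOpen_iff.1 hopen q hne
  set η := min 1 (ε ^ 2 / 4) with hη
  have hη0 : 0 < η := by positivity
  have hsub : sphereCap q η ⊆ {x | ¬ G x = 0} := by
    rintro x ⟨hx1, hx2⟩
    refine hball ?_
    rw [Metric.mem_ball, dist_eq_norm]
    have h1 : ‖x - q‖ ^ 2 = 2 * (1 - ⟪x, q⟫) := by rw [norm_sub_sq_real, hx1, hq]; ring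
    have h2 : η ≤ ε ^ 2 / 4 := min_le_right _ _
    refine lt_of_pow_lt_pow_left₀ 2 hε.le ?_
    have : 0 < ε ^ 2 := by positivity
    nlinarith
  have h0 : sphereUniform d (sphereCap q η) = 0 := measure_mono_null hsub h
  have h1 := (hcap q hq η hη0).1 (min_le_left _ _)
  rw [measureReal_def, h0] at h1
  have : 0 < c * η ^ (((d : ℝ) - 1) / 2) := by positivity
  simp at h1
  linarith

/-- If almost every query is mapped to a minimizer of the risk, the linear map is a homothety. -/
lemma exists_eq_smul_id_of_ae_parallel (hd : 2 ≤ d)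
    (T : EuclideanSpace ℝ (Fin d) →L[ℝ] EuclideanSpace ℝ (Fin d))
    (h : ∀ᵐ q ∂(sphereUniform d), ∃ w : ℝ, T q = w • q) :
    ∃ w : ℝ, ∀ q, T q = w • q := by
  let G : EuclideanSpace ℝ (Fin d) → EuclideanSpace ℝ (Fin d) := fun q => T q - ⟪T q, q⟫ • q
  have hG : Continuous G := by fun_prop
  have hG0 : ∀ᵐ q ∂(sphereUniform d), G q = 0 := by
    filter_upwards [h, ae_norm_eq_one_sphereUniform d] with q ⟨w, hw⟩ hq
    simp [G, hw, inner_smul_left, hq]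
  have h1 : ∀ q, ¬ LinearIndependent ℝ ![q, (T : EuclideanSpace ℝ (Fin d) →ₗ[ℝ] _) q] := by
    intro q hli
    rw [LinearIndependent.pair_iff' (by
      intro h0
      have := hli.ne_zero 0
      simp [h0] at this)] at hli
    have hq0 : q ≠ 0 := by
      rintro rfl
      exact hli 0 (by simp)
    have h' : ‖q‖ ≠ 0 := norm_ne_zero_iff.2 hq0
    have h2 := eq_zero_of_ae_sphereUniform hd hG hG0 (q := ‖q‖⁻¹ • q)
      (by rw [norm_smul, norm_inv, norm_norm, inv_mul_cancel₀ h'])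
    simp only [G, map_smul, sub_eq_zero] at h2
    generalize ⟪‖q‖⁻¹ • T q, ‖q‖⁻¹ • q⟫ = c at h2
    refine hli c ?_
    have h3 := congrArg (fun y => ‖q‖ • y) h2
    simp only [smul_smul, mul_inv_cancel₀ h', one_smul] at h3
    rw [ContinuousLinearMap.coe_coe, h3]
    congr 1
    field_simp
  obtain ⟨w, hw⟩ := LinearMap.exists_eq_smul_id_of_forall_notLinearIndependent h1
  exact ⟨w, fun q => by simpa using congrArg (fun f => f q) hw⟩

end Risk

section Reduction

variable {d n : ℕ}

lemma quadForm_eq_inner (M : Matrix (Fin d) (Fin d) ℝ) (x y : EuclideanSpace ℝ (Fin d)) :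
    quadForm M x y = ⟪x, Matrix.toEuclideanCLM (𝕜 := ℝ) M y⟫ := by
  rw [EuclideanSpace.inner_eq_star_dotProduct]
  simp only [quadForm, dotProduct, Matrix.mulVec, Matrix.ofLp_toEuclideanCLM, Finset.sum_mul]
  refine Finset.sum_congr rfl fun a _ => Finset.sum_congr rfl fun b _ => ?_
  simp
  ring

lemma softmaxPred_eq_sum (M : Matrix (Fin d) (Fin d) ℝ)
    (x : Fin (n + 1) → EuclideanSpace ℝ (Fin d)) (y : Fin n → ℝ) :
    softmaxPred M x y = ∑ i, attnWeight (Matrix.toEuclideanCLM (𝕜 := ℝ) M (x (Fin.last n)))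
      (fun j : Fin n => x j.castSucc) i * y i := by
  simp only [softmaxPred, attnWeight, quadForm_eq_inner, Finset.sum_div]
  exact Finset.sum_congr rfl fun i _ => by ring

lemma integral_sq_add_sum_noise {ν : Measure ℝ} [IsProbabilityMeasure ν]
    (h2 : Integrable (fun t : ℝ => t ^ 2) ν) (h0 : ∫ t, t ∂ν = 0) (D : ℝ) (p : Fin n → ℝ) :
    ∫ e : Fin n → ℝ, (D + ∑ i, p i * e i) ^ 2 ∂(Measure.pi fun _ : Fin n => ν)
      = D ^ 2 + (∫ t, t ^ 2 ∂ν) * ∑ i, p i ^ 2 := by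
  have hmem : MemLp (fun t : ℝ => t) 2 ν :=
    (memLp_two_iff_integrable_sq measurable_id.aestronglyMeasurable).2 h2
  have hpres := fun i : Fin n => measurePreserving_eval (fun _ : Fin n => ν) i
  have hm : ∀ i, MemLp (fun e : Fin n → ℝ => e i) 2 (Measure.pi fun _ : Fin n => ν) :=
    fun i => hmem.comp_measurePreserving (hpres i)
  have hint : ∀ i, Integrable (fun e : Fin n → ℝ => e i) (Measure.pi fun _ : Fin n => ν) :=
    fun i => (hm i).integrable (by norm_num)
  have hint2 : ∀ i j, Integrable (fun e : Fin n → ℝ => e i * e j)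
      (Measure.pi fun _ : Fin n => ν) := fun i j => (hm i).integrable_mul (hm j)
  have hval : ∀ (f : ℝ → ℝ), Measurable f → ∀ i,
      ∫ e : Fin n → ℝ, f (e i) ∂(Measure.pi fun _ : Fin n => ν) = ∫ t, f t ∂ν := by
    intro f hf i
    have h := integral_map (μ := Measure.pi fun _ : Fin n => ν)
      (hpres i).measurable.aemeasurable (f := f) hf.aestronglyMeasurable
    rw [(hpres i).map_eq] at h
    exact h.symm
  have hind : ProbabilityTheory.iIndepFun
      (fun (i : Fin n) (e : Fin n → ℝ) => e i) (Measure.pi fun _ : Fin n => ν) :=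
    ProbabilityTheory.iIndepFun_pi (X := fun _ t => t) fun _ => aemeasurable_id
  have hcross : ∀ i j, ∫ e : Fin n → ℝ, e i * e j ∂(Measure.pi fun _ : Fin n => ν)
      = if i = j then ∫ t, t ^ 2 ∂ν else 0 := by
    intro i j
    split_ifs with hij
    · subst hij
      simp only [← sq]
      exact hval (fun t => t ^ 2) (by fun_prop) i
    · have h := (hind.indepFun hij).integral_mul_eq_mul_integral
        (hm i).aestronglyMeasurable (hm j).aestronglyMeasurable
      have h' := hval (fun t => t) measurable_id i
      rw [h0] at h'
      refine Eq.trans h ?_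
      rw [h', zero_mul]
  have hexp : ∀ e : Fin n → ℝ, (D + ∑ i, p i * e i) ^ 2
      = (D ^ 2 + ∑ i, 2 * D * p i * e i) + ∑ i, ∑ j, p i * p j * (e i * e j) := by
    intro e
    have h1 : (∑ i, p i * e i) * (∑ i, p i * e i) = ∑ i, ∑ j, p i * p j * (e i * e j) := by
      rw [Finset.sum_mul_sum]
      exact Finset.sum_congr rfl fun i _ => Finset.sum_congr rfl fun j _ => by ring
    have h3 : ∑ i, 2 * D * p i * e i = 2 * D * ∑ i, p i * e i := by
      rw [Finset.mul_sum]; exact Finset.sum_congr rfl fun i _ => by ring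
    rw [← h1, h3]; ring
  simp only [hexp]
  have hi1 : Integrable (fun e : Fin n → ℝ => ∑ i, 2 * D * p i * e i)
      (Measure.pi fun _ : Fin n => ν) := integrable_finsetSum _ fun i _ => (hint i).const_mul _
  have hi2 : ∀ i, Integrable (fun e : Fin n → ℝ => ∑ j, p i * p j * (e i * e j))
      (Measure.pi fun _ : Fin n => ν) :=
    fun i => integrable_finsetSum _ fun j _ => (hint2 i j).const_mul _
  have hi3 : Integrable (fun e : Fin n → ℝ => D ^ 2 + ∑ i, 2 * D * p i * e i)
      (Measure.pi fun _ : Fin n => ν) := (integrable_const _).add hi1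
  rw [integral_add hi3 (integrable_finsetSum _ fun i _ => hi2 i),
    integral_add (integrable_const _) hi1,
    integral_finsetSum _ fun i _ => (hint i).const_mul _,
    integral_finsetSum _ fun i _ => hi2 i]
  have h4 : ∀ i, ∫ e : Fin n → ℝ, 2 * D * p i * e i ∂(Measure.pi fun _ : Fin n => ν) = 0 := by
    intro i
    have h' := hval (fun t => t) measurable_id i
    rw [integral_const_mul, h', h0, mul_zero]
  have h5 : ∀ i, ∫ e : Fin n → ℝ, ∑ j, p i * p j * (e i * e j) ∂(Measure.pi fun _ : Fin n => ν)
      = (∫ t, t ^ 2 ∂ν) * p i ^ 2 := by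
    intro i
    rw [integral_finsetSum _ fun j _ => (hint2 i j).const_mul _]
    simp only [integral_const_mul, hcross, mul_ite, mul_zero, Finset.sum_ite_eq, Finset.mem_univ,
      if_true]
    ring
  simp only [h4, h5, ← Finset.mul_sum]
  simp

lemma isProbabilityMeasure_unifIcc {L : ℝ} (hL : 0 < L) : IsProbabilityMeasure (unifIcc L) := by
  refine ⟨?_⟩
  have h : ENNReal.ofReal (L - -L) = ENNReal.ofReal (2 * L) := by congr 1; ring
  rw [unifIcc, Measure.smul_apply, Measure.restrict_apply_univ, Real.volume_Icc, h, smul_eq_mul]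
  exact ENNReal.inv_mul_cancel (by simpa using hL) ENNReal.ofReal_ne_top

lemma integral_sq_unifIcc {L : ℝ} (hL : 0 < L) : ∫ t, t ^ 2 ∂(unifIcc L) = L ^ 2 / 3 := by
  rw [unifIcc, integral_smul_measure, integral_Icc_eq_integral_Ioc,
    ← intervalIntegral.integral_of_le (by linarith), integral_pow, ENNReal.toReal_inv,
    ENNReal.toReal_ofReal (by linarith), smul_eq_mul]
  field_simp
  ring

lemma integrable_sq_unifIcc (L : ℝ) (hL : 0 < L) : Integrable (fun t => t ^ 2) (unifIcc L) := by
  rw [unifIcc]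
  refine Integrable.smul_measure ?_ (by simpa using hL)
  exact (continuous_pow 2).continuousOn.integrableOn_compact isCompact_Icc

lemma integral_comp_sphereUniform (R : EuclideanSpace ℝ (Fin d) ≃ₗᵢ[ℝ] EuclideanSpace ℝ (Fin d))
    (f : EuclideanSpace ℝ (Fin d) → ℝ) :
    ∫ x, f (R x) ∂(sphereUniform d) = ∫ x, f x ∂(sphereUniform d) :=
  (measurePreserving_sphereUniform R).integral_comp' (f := R.toHomeomorph.toMeasurableEquiv) f

lemma integral_coord_mul_coord (hd : 2 ≤ d) (a b : Fin d) :
    ∫ v : EuclideanSpace ℝ (Fin d), v a * v b ∂(sphereUniform d)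
      = if a = b then (d : ℝ)⁻¹ else 0 := by
  have := isProbabilityMeasure_sphereUniform hd
  have hcoord : ∀ (v : EuclideanSpace ℝ (Fin d)) a, v a = ⟪v, EuclideanSpace.single a 1⟫ := by
    intro v a; simp [EuclideanSpace.inner_single_right]
  split_ifs with hab
  · subst hab
    have hsame : ∀ b, ∫ v : EuclideanSpace ℝ (Fin d), v b * v b ∂(sphereUniform d)
        = ∫ v : EuclideanSpace ℝ (Fin d), v a * v a ∂(sphereUniform d) := by
      intro b
      let e := fun a : Fin d => EuclideanSpace.single a (1 : ℝ)
      have hR := Submodule.reflection_sub (v := e a) (w := e b) (by simp [e])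
      set R := (ℝ ∙ (e a - e b))ᗮ.reflection
      rw [← integral_comp_sphereUniform R]
      refine integral_congr_ae (ae_of_all _ fun v => ?_)
      have : (R v) b = v a := by
        rw [hcoord, hcoord]
        change ⟪R v, e b⟫ = ⟪v, e a⟫
        rw [← hR, R.inner_map_map]
      simp only [this]
    have hsum : ∑ b, ∫ v : EuclideanSpace ℝ (Fin d), v b * v b ∂(sphereUniform d) = 1 := by
      rw [← integral_finsetSum _ fun b _ => integrable_sphereUniform hd (by fun_prop)]
      have : ∀ᵐ v : EuclideanSpace ℝ (Fin d) ∂(sphereUniform d), ∑ b, v b * v b = (1 : ℝ) := by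
        filter_upwards [ae_norm_eq_one_sphereUniform d] with v hv
        have := EuclideanSpace.real_norm_sq_eq v
        rw [hv] at this
        simpa [sq] using this.symm
      rw [integral_congr_ae this]; simp
    simp only [hsame, Finset.sum_const, Finset.card_univ, Fintype.card_fin, nsmul_eq_mul] at hsum
    exact eq_inv_of_mul_eq_one_right hsum
  · obtain ⟨R, hRz, hR⟩ := exists_reflection (EuclideanSpace.single a (1 : ℝ))
    have hb := hR (EuclideanSpace.single b 1) (by
      rw [EuclideanSpace.inner_single_right]; simp [hab])
    have h1 := integral_comp_sphereUniform R fun v => v a * v b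
    have h2 : ∀ v : EuclideanSpace ℝ (Fin d), (R v) a * (R v) b = -(v a * v b) := by
      intro v
      have h3 := R.inner_map_map v (EuclideanSpace.single a (1 : ℝ))
      have h4 := R.inner_map_map v (EuclideanSpace.single b (1 : ℝ))
      rw [hRz, inner_neg_right, ← hcoord, ← hcoord] at h3
      rw [hb, ← hcoord, ← hcoord] at h4
      rw [h4]; linear_combination -(v b) * h3
    simp only [h2, integral_neg] at h1
    linarith

end Reduction

section Loss

variable {d n : ℕ}

/-- Splitting off the query from the covariates. -/
lemma integral_sphereSample_succ (hd : 2 ≤ d)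
    {G : EuclideanSpace ℝ (Fin d) × (Fin n → EuclideanSpace ℝ (Fin d)) → ℝ} (hG : Continuous G) :
    Integrable (fun q => ∫ x, G (q, x) ∂(sphereSample d n)) (sphereUniform d) ∧
    ∫ x, G (x (Fin.last n), fun j => x j.castSucc) ∂(sphereSample d (n + 1))
      = ∫ q, ∫ x, G (q, x) ∂(sphereSample d n) ∂(sphereUniform d) := by
  have := isProbabilityMeasure_sphereUniform hd
  have := isProbabilityMeasure_sphereSample (n := n) hd
  let e := MeasurableEquiv.piFinSuccAbove
    (fun _ : Fin (n + 1) => EuclideanSpace ℝ (Fin d)) (Fin.last n)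
  have hp : MeasurePreserving e (sphereSample d (n + 1))
      ((sphereUniform d).prod (sphereSample d n)) :=
    measurePreserving_piFinSuccAbove (fun _ : Fin (n + 1) => sphereUniform d) (Fin.last n)
  have he : ∀ x, e x = (x (Fin.last n), fun j => x j.castSucc) := by
    intro x
    refine Prod.ext rfl (funext fun j => ?_)
    change x ((Fin.last n).succAbove j) = _
    rw [Fin.succAbove_last]
  have hint : Integrable G ((sphereUniform d).prod (sphereSample d n)) := by
    rw [← hp.integrable_comp_emb e.measurableEmbedding]
    have hc : Continuous (G ∘ e) := by
      have : G ∘ e = fun x => G (x (Fin.last n), fun j => x j.castSucc) := by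
        ext x; simp [he]
      rw [this]
      exact hG.comp (by fun_prop)
    exact integrable_sphereSample hd hc
  refine ⟨hint.integral_prod_left, ?_⟩
  rw [← integral_prod _ hint, ← hp.integral_comp']
  simp only [he]

lemma integral_affineTask (hd : 2 ≤ d) {L : ℝ} (hL : 0 < L) (C : Fin d → Fin d → ℝ) (c : ℝ) :
    ∫ θ, (∑ a, ∑ b, θ.2.1 ^ 2 * (θ.1 a * θ.1 b) * C a b) + c ∂(affineTask d L)
      = L ^ 2 / (3 * d) * ∑ a, C a a + c := by
  have := isProbabilityMeasure_sphereUniform hd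
  have := isProbabilityMeasure_unifIcc hL
  have hi : ∀ a b, Integrable (fun θ : EuclideanSpace ℝ (Fin d) × ℝ × ℝ =>
      θ.2.1 ^ 2 * (θ.1 a * θ.1 b) * C a b) (affineTask d L) := by
    intro a b
    refine Integrable.mul_const ?_ _
    have h1 : Integrable (fun v : EuclideanSpace ℝ (Fin d) => v a * v b) (sphereUniform d) :=
      integrable_sphereUniform hd (by fun_prop)
    have h2 : Integrable (fun z : ℝ × ℝ => z.1 ^ 2) ((unifIcc L).prod (unifIcc L)) :=
      (integrable_sq_unifIcc L hL).comp_fst _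
    rw [affineTask]
    simpa only [mul_comm] using h1.mul_prod h2
  have hv : ∀ a b, ∫ θ, θ.2.1 ^ 2 * (θ.1 a * θ.1 b) * C a b ∂(affineTask d L)
      = if a = b then L ^ 2 / (3 * d) * C a b else 0 := by
    intro a b
    rw [integral_mul_const]
    have h1 : ∫ z : ℝ × ℝ, z.1 ^ 2 ∂((unifIcc L).prod (unifIcc L)) = L ^ 2 / 3 := by
      have := integral_prod_mul (μ := unifIcc L) (ν := unifIcc L) (fun t : ℝ => t ^ 2)
        (fun _ : ℝ => (1 : ℝ))
      simpa [integral_sq_unifIcc hL] using this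
    have h2 := integral_prod_mul (μ := sphereUniform d) (ν := (unifIcc L).prod (unifIcc L))
      (fun v : EuclideanSpace ℝ (Fin d) => v a * v b) (fun z : ℝ × ℝ => z.1 ^ 2)
    rw [h1, integral_coord_mul_coord hd] at h2
    have h3 : ∫ θ, θ.2.1 ^ 2 * (θ.1 a * θ.1 b) ∂(affineTask d L)
        = (if a = b then (d : ℝ)⁻¹ else 0) * (L ^ 2 / 3) := by
      rw [← h2, affineTask]
      exact integral_congr_ae (ae_of_all _ fun θ => mul_comm _ _)
    rw [h3]
    split_ifs
    · field_simp
    · simp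
  have : IsProbabilityMeasure (affineTask d L) := by unfold affineTask; infer_instance
  rw [integral_add (integrable_finsetSum _ fun a _ => integrable_finsetSum _ fun b _ => hi a b)
    (integrable_const _),
    integral_finsetSum _ fun a _ => integrable_finsetSum _ fun b _ => hi a b]
  simp only [integral_finsetSum _ fun b _ => hi _ b, hv, Finset.sum_ite_eq, Finset.mem_univ,
    if_true, ← Finset.mul_sum]
  simp

lemma integrable_attnRisk (hd : 2 ≤ d) (hn : 0 < n) (s t : ℝ)
    (T : EuclideanSpace ℝ (Fin d) →L[ℝ] EuclideanSpace ℝ (Fin d)) :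
    Integrable (fun q => attnRisk n s t (T q) q) (sphereUniform d) ∧
    ∫ q, attnRisk n s t (T q) q ∂(sphereUniform d)
      = s * (∫ x, ‖attnMean (T (x (Fin.last n))) (fun j : Fin n => x j.castSucc)
            - x (Fin.last n)‖ ^ 2 ∂(sphereSample d (n + 1)))
        + t * ∫ x, ∑ i, attnWeight (T (x (Fin.last n))) (fun j : Fin n => x j.castSucc) i ^ 2
            ∂(sphereSample d (n + 1)) := by
  have hT : Continuous fun z : EuclideanSpace ℝ (Fin d) × (Fin n → EuclideanSpace ℝ (Fin d)) =>
      (T z.1, z.2) := by fun_prop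
  have hm : Continuous fun z : EuclideanSpace ℝ (Fin d) × (Fin n → EuclideanSpace ℝ (Fin d)) =>
      ‖attnMean (T z.1) z.2 - z.1‖ ^ 2 :=
    (((continuous_attnMean hn).comp hT).sub continuous_fst).norm.pow 2
  have hw : Continuous fun z : EuclideanSpace ℝ (Fin d) × (Fin n → EuclideanSpace ℝ (Fin d)) =>
      ∑ i, attnWeight (T z.1) z.2 i ^ 2 :=
    continuous_finsetSum Finset.univ fun i _ => ((continuous_attnWeight hn i).comp hT).pow 2
  obtain ⟨h1, h2⟩ := integral_sphereSample_succ hd hm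
  obtain ⟨h3, h4⟩ := integral_sphereSample_succ hd hw
  refine ⟨(h1.const_mul s).add (h3.const_mul t), ?_⟩
  rw [h2, h4, ← integral_const_mul, ← integral_const_mul]
  exact integral_add (h1.const_mul s) (h3.const_mul t)

lemma iclLoss_affineTask (hd : 2 ≤ d) (hn : 0 < n) {L : ℝ} (hL : 0 < L) {ν : Measure ℝ}
    [IsProbabilityMeasure ν] (h2 : Integrable (fun t : ℝ => t ^ 2) ν) (h0 : ∫ t, t ∂ν = 0)
    (M : Matrix (Fin d) (Fin d) ℝ) :
    iclLoss d n (affineTask d L) ν affineF M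
      = ∫ q, attnRisk n (L ^ 2 / (3 * d)) (∫ t, t ^ 2 ∂ν) (Matrix.toEuclideanCLM (𝕜 := ℝ) M q) q
          ∂(sphereUniform d) := by
  set T := Matrix.toEuclideanCLM (𝕜 := ℝ) M with hT
  set σ2 := ∫ t, t ^ 2 ∂ν with hσ2
  rw [(integrable_attnRisk hd hn _ _ T).2]
  let P : (Fin (n + 1) → EuclideanSpace ℝ (Fin d)) → Fin n → ℝ := fun x i =>
    attnWeight (T (x (Fin.last n))) (fun j : Fin n => x j.castSucc) i
  let Z : (Fin (n + 1) → EuclideanSpace ℝ (Fin d)) → EuclideanSpace ℝ (Fin d) := fun x =>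
    attnMean (T (x (Fin.last n))) (fun j : Fin n => x j.castSucc) - x (Fin.last n)
  have hc : Continuous fun x : Fin (n + 1) → EuclideanSpace ℝ (Fin d) =>
      (T (x (Fin.last n)), fun j : Fin n => x j.castSucc) := by fun_prop
  have hZ : Continuous Z := ((continuous_attnMean hn).comp hc).sub (continuous_apply _)
  have hP : Continuous fun x => ∑ i, P x i ^ 2 :=
    continuous_finsetSum Finset.univ fun i _ => ((continuous_attnWeight hn i).comp hc).pow 2
  have hZk : ∀ k, Continuous fun x => Z x k := fun k => by fun_prop
  have hnoise : ∀ (θ : EuclideanSpace ℝ (Fin d) × ℝ × ℝ)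
      (x : Fin (n + 1) → EuclideanSpace ℝ (Fin d)),
      ∫ e : Fin n → ℝ, (softmaxPred M x (fun i => affineF θ (x i.castSucc) + e i)
          - affineF θ (x (Fin.last n))) ^ 2 ∂(Measure.pi fun _ : Fin n => ν)
        = (∑ a, ∑ b, θ.2.1 ^ 2 * (θ.1 a * θ.1 b) * (Z x a * Z x b)) + σ2 * ∑ i, P x i ^ 2 := by
    intro θ x
    have h1 : ∀ z : EuclideanSpace ℝ (Fin d), affineF θ z = θ.2.1 * ⟪z, θ.1⟫ + θ.2.2 := by
      intro z
      simp [affineF, PiLp.inner_apply]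
    have h3 : ∑ i, P x i = 1 := sum_attnWeight hn _ _
    have h4 : ∀ e : Fin n → ℝ, softmaxPred M x (fun i => affineF θ (x i.castSucc) + e i)
          - affineF θ (x (Fin.last n)) = θ.2.1 * ⟪Z x, θ.1⟫ + ∑ i, P x i * e i := by
      intro e
      have h5 : ∑ i, P x i * (θ.2.1 * ⟪x i.castSucc, θ.1⟫ + θ.2.2 + e i)
          = θ.2.1 * (∑ i, P x i * ⟪x i.castSucc, θ.1⟫) + θ.2.2 * (∑ i, P x i)
            + ∑ i, P x i * e i := by
        rw [Finset.mul_sum, Finset.mul_sum, ← Finset.sum_add_distrib, ← Finset.sum_add_distrib]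
        exact Finset.sum_congr rfl fun i _ => by ring
      have h6 : ⟪Z x, θ.1⟫ = (∑ i, P x i * ⟪x i.castSucc, θ.1⟫) - ⟪x (Fin.last n), θ.1⟫ := by
        simp only [Z, inner_sub_left, attnMean, sum_inner, inner_smul_left, P, conj_trivial]
      rw [softmaxPred_eq_sum]
      simp only [h1]
      rw [h6]
      refine (congrArg (· - _) h5).trans ?_
      rw [h3]; ring
    simp only [h4]
    rw [integral_sq_add_sum_noise h2 h0]
    congr 1
    have h7 : ⟪Z x, θ.1⟫ = ∑ a, θ.1 a * Z x a := by simp [PiLp.inner_apply]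
    rw [h7, mul_pow, sq (∑ a, _), Finset.sum_mul_sum, Finset.mul_sum]
    refine Finset.sum_congr rfl fun a _ => ?_
    rw [Finset.mul_sum]
    exact Finset.sum_congr rfl fun b _ => by ring
  have hx : ∀ θ : EuclideanSpace ℝ (Fin d) × ℝ × ℝ,
      ∫ x, ((∑ a, ∑ b, θ.2.1 ^ 2 * (θ.1 a * θ.1 b) * (Z x a * Z x b)) + σ2 * ∑ i, P x i ^ 2)
        ∂(sphereSample d (n + 1))
      = (∑ a, ∑ b, θ.2.1 ^ 2 * (θ.1 a * θ.1 b)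
          * ∫ x, Z x a * Z x b ∂(sphereSample d (n + 1)))
        + σ2 * ∫ x, ∑ i, P x i ^ 2 ∂(sphereSample d (n + 1)) := by
    intro θ
    have hi : ∀ a b, Integrable (fun x => θ.2.1 ^ 2 * (θ.1 a * θ.1 b) * (Z x a * Z x b))
        (sphereSample d (n + 1)) := fun a b =>
      (integrable_sphereSample hd ((hZk a).mul (hZk b))).const_mul _
    rw [integral_add
      (integrable_finsetSum _ fun a _ => integrable_finsetSum _ fun b _ => hi a b)
      ((integrable_sphereSample hd hP).const_mul _),
      integral_finsetSum _ fun a _ => integrable_finsetSum _ fun b _ => hi a b,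
      integral_const_mul]
    simp only [integral_finsetSum _ fun b _ => hi _ b, integral_const_mul]
  have hsum : ∑ a, ∫ x, Z x a * Z x a ∂(sphereSample d (n + 1))
      = ∫ x, ‖Z x‖ ^ 2 ∂(sphereSample d (n + 1)) := by
    have hi : ∀ a, Integrable (fun x => Z x a * Z x a) (sphereSample d (n + 1)) := fun a =>
      integrable_sphereSample hd ((hZk a).mul (hZk a))
    rw [← integral_finsetSum _ fun a _ => hi a]
    simp only [EuclideanSpace.real_norm_sq_eq]
    simp only [sq]
  rw [iclLoss]
  simp only [hnoise]
  change ∫ θ, ∫ x, _ ∂(sphereSample d (n + 1)) ∂_ = _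
  simp only [hx]
  rw [integral_affineTask hd hL, hsum]

/-- A global minimizer of the affine pretraining loss is a homothety whose scale minimizes the
risk, provided the risk can be made smaller than that of the zero map. -/
lemma exists_smul_one_of_minimizer (hd : 2 ≤ d) (hn : 0 < n) {L : ℝ} (hL : 0 < L)
    {ν : Measure ℝ} [IsProbabilityMeasure ν] (h2 : Integrable (fun t : ℝ => t ^ 2) ν)
    (h0 : ∫ t, t ∂ν = 0) {q₀ : EuclideanSpace ℝ (Fin d)} (hq₀ : ‖q₀‖ = 1)
    {w₀ : ℝ} (hw₀ : attnRisk n (L ^ 2 / (3 * d)) (∫ t, t ^ 2 ∂ν) (w₀ • q₀) q₀ < L ^ 2 / (3 * d))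
    {M : Matrix (Fin d) (Fin d) ℝ}
    (hM : ∀ M', iclLoss d n (affineTask d L) ν affineF M
      ≤ iclLoss d n (affineTask d L) ν affineF M') :
    ∃ w : ℝ, M = w • (1 : Matrix (Fin d) (Fin d) ℝ) ∧
      ∀ w' : ℝ, attnRisk n (L ^ 2 / (3 * d)) (∫ t, t ^ 2 ∂ν) (w • q₀) q₀
        ≤ attnRisk n (L ^ 2 / (3 * d)) (∫ t, t ^ 2 ∂ν) (w' • q₀) q₀ := by
  have := isProbabilityMeasure_sphereUniform hd
  set s := L ^ 2 / (3 * d) with hs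
  set σ2 := ∫ t, t ^ 2 ∂ν with hσ2
  have hs0 : 0 ≤ s := by positivity
  have hσ0 : 0 ≤ σ2 := integral_nonneg fun t => sq_nonneg t
  set T := Matrix.toEuclideanCLM (𝕜 := ℝ) M with hT
  set m := iclLoss d n (affineTask d L) ν affineF M with hm
  have hscal : ∀ w : ℝ, iclLoss d n (affineTask d L) ν affineF (w • 1)
      = attnRisk n s σ2 (w • q₀) q₀ := by
    intro w
    rw [iclLoss_affineTask hd hn hL h2 h0]
    have : ∀ᵐ q ∂(sphereUniform d), attnRisk n s σ2
        (Matrix.toEuclideanCLM (𝕜 := ℝ) (w • (1 : Matrix (Fin d) (Fin d) ℝ)) q) q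
        = attnRisk n s σ2 (w • q₀) q₀ := by
      filter_upwards [ae_norm_eq_one_sphereUniform d] with q hq
      rw [map_smul, map_one]
      exact attnRisk_smul_self_eq hd hn s σ2 w (hq.trans hq₀.symm)
    rw [integral_congr_ae this]
    simp
  have hle : ∀ w : ℝ, m ≤ attnRisk n s σ2 (w • q₀) q₀ := fun w => hscal w ▸ hM _
  have hle' : ∀ q : EuclideanSpace ℝ (Fin d), ‖q‖ = 1 →
      ∀ w : ℝ, m ≤ attnRisk n s σ2 (w • q) q := fun q hq w => by
    rw [attnRisk_smul_self_eq hd hn s σ2 w (hq.trans hq₀.symm)]; exact hle w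
  have hms : m < s := (hle w₀).trans_lt hw₀
  have hint := (integrable_attnRisk hd hn s σ2 T).1
  have hmeq : m = ∫ q, attnRisk n s σ2 (T q) q ∂(sphereUniform d) :=
    iclLoss_affineTask hd hn hL h2 h0 M
  have hae : ∀ᵐ q ∂(sphereUniform d), attnRisk n s σ2 (T q) q = m := by
    have h3 : 0 ≤ᵐ[sphereUniform d] fun q => attnRisk n s σ2 (T q) q - m := by
      filter_upwards [ae_norm_eq_one_sphereUniform d] with q hq
      exact sub_nonneg.2 (le_attnRisk hd hn hq (hle' q hq) (T q))
    have h4 := (integral_eq_zero_iff_of_nonneg_ae h3 (hint.sub (integrable_const m))).1 (by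
      rw [integral_sub hint (integrable_const m), ← hmeq]; simp)
    filter_upwards [h4] with q hq
    exact sub_eq_zero.1 hq
  have hpar : ∀ᵐ q ∂(sphereUniform d), ∃ w : ℝ, T q = w • q := by
    filter_upwards [hae, ae_norm_eq_one_sphereUniform d] with q h3 hq
    exact eq_smul_of_attnRisk_le hd hn hs0 hσ0 hms hq (hle' q hq) h3.le
  obtain ⟨w, hw⟩ := exists_eq_smul_id_of_ae_parallel hd T hpar
  have hMw : M = w • (1 : Matrix (Fin d) (Fin d) ℝ) := by
    refine EquivLike.injective (Matrix.toEuclideanCLM (n := Fin d) (𝕜 := ℝ)) ?_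
    rw [map_smul, map_one, ← hT]
    exact ContinuousLinearMap.ext fun q => hw q
  refine ⟨w, hMw, fun w' => ?_⟩
  rw [← hscal w, ← hMw]
  exact hle w'

end Loss

section Scaling

variable {d : ℕ}

lemma exists_bias_ge (hd : 2 ≤ d) :
    ∃ c : ℝ, 0 < c ∧ ∀ n : ℕ, 0 < n → ∀ q : EuclideanSpace ℝ (Fin d), ‖q‖ = 1 →
      ∀ W : ℝ, 1 ≤ W → 1 ≤ n * W ^ (-(((d : ℝ) - 1) / 2)) → ∀ w ≤ W,
      c * (W⁻¹) ^ 2 ≤ ∫ x, ‖attnMean (n := n) (w • q) x - q‖ ^ 2 ∂(sphereSample d n) := by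
  obtain ⟨c, hc, hlow⟩ := exists_heightLaplace_ge hd
  obtain ⟨b, hb, hmom⟩ := exists_heightMoment_ge hd
  refine ⟨(b * (c / (1 + c))) ^ 2, by positivity, fun n hn q hq W hW hN w hw => ?_⟩
  refine le_trans ?_ (sq_integral_attnHeight_le hd hn hq w)
  rw [← mul_pow]
  refine pow_le_pow_left₀ (by positivity) ?_ 2
  have h1 : ∫ x, attnHeight (n := n) q W x ∂(sphereSample d n)
      ≤ ∫ x, attnHeight (n := n) q w x ∂(sphereSample d n) :=
    integral_mono (integrable_sphereSample hd (continuous_attnHeight hn q W))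
      (integrable_sphereSample hd (continuous_attnHeight hn q w))
      fun x => attnHeight_antitone hn q x hw
  refine le_trans ?_ ((integral_attnHeight_ge hd hn hq (by linarith)).trans h1)
  have hn0 : (0 : ℝ) < n := by exact_mod_cast hn
  set y := n * heightLaplace q W with hy
  have hy0 : c ≤ y := by
    calc c ≤ c * (n * W ^ (-(((d : ℝ) - 1) / 2))) := le_mul_of_one_le_right hc.le hN
      _ = n * (c * W ^ (-(((d : ℝ) - 1) / 2))) := by ring
      _ ≤ y := by rw [hy]; gcongr; exact hlow q hq W hW
  have h2 : b * W⁻¹ * y ≤ n * heightMoment q W := by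
    calc _ = n * (b * (W⁻¹ * heightLaplace q W)) := by rw [hy]; ring
      _ ≤ _ := by gcongr; exact hmom q hq W hW
  have h3 : c / (1 + c) ≤ y / (1 + y) := by
    rw [div_le_div_iff₀ (by linarith) (by linarith)]; nlinarith
  calc b * (c / (1 + c)) * W⁻¹ = b * W⁻¹ * (c / (1 + c)) := by ring
    _ ≤ b * W⁻¹ * (y / (1 + y)) := by gcongr
    _ = b * W⁻¹ * y / (1 + y) := by ring
    _ ≤ _ := by
      have : 0 < 1 + y := by linarith
      gcongr

lemma exists_collision_ge (hd : 2 ≤ d) :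
    ∃ c : ℝ, 0 < c ∧ ∀ n : ℕ, 0 < n → ∀ q : EuclideanSpace ℝ (Fin d), ‖q‖ = 1 →
      ∀ W : ℝ, 1 ≤ W → 1 ≤ n * W ^ (-(((d : ℝ) - 1) / 2)) → ∀ w, W ≤ w →
      c * (n * W ^ (-(((d : ℝ) - 1) / 2)))⁻¹
        ≤ ∫ x, ∑ i : Fin n, attnWeight (w • q) x i ^ 2 ∂(sphereSample d n) := by
  obtain ⟨c, hc, hlow⟩ := exists_heightLaplace_ge hd
  obtain ⟨C, hC, hup⟩ := exists_heightLaplace_le hd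
  refine ⟨c * 2 ^ (-(((d : ℝ) - 1) / 2)) / (1 + C) ^ 2, by positivity,
    fun n hn q hq W hW hN w hw => ?_⟩
  have h1 : ∫ x, ∑ i : Fin n, attnWeight (W • q) x i ^ 2 ∂(sphereSample d n)
      ≤ ∫ x, ∑ i : Fin n, attnWeight (w • q) x i ^ 2 ∂(sphereSample d n) :=
    integral_mono (integrable_sphereSample hd (continuous_sum_attnWeight_sq hn _))
      (integrable_sphereSample hd (continuous_sum_attnWeight_sq hn _))
      fun x => sum_attnWeight_sq_monotoneOn hn q x
        (show (0 : ℝ) ≤ W by linarith) (show (0 : ℝ) ≤ w by linarith) hw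
  refine le_trans ?_ ((integral_sum_attnWeight_sq_ge hd hn hq (by linarith)).trans h1)
  have hn0 : (0 : ℝ) < n := by exact_mod_cast hn
  set ρ := ((d : ℝ) - 1) / 2 with hρ
  have hW0 : 0 < W := by linarith
  have h2 := hlow q hq (2 * W) (by linarith)
  rw [Real.mul_rpow (by norm_num) hW0.le] at h2
  have h3 := hup q hq W hW0
  have h4 : 1 + n * heightLaplace q W ≤ (1 + C) * (n * W ^ (-ρ)) := by
    have := mul_le_mul_of_nonneg_left h3 hn0.le
    nlinarith
  have h5 : 0 ≤ heightLaplace q W := heightLaplace_nonneg q W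
  have h6 : 0 ≤ n * heightLaplace q (2 * W) := mul_nonneg hn0.le (heightLaplace_nonneg q _)
  set P := W ^ (-ρ) with hP
  have hP0 : 0 < P := Real.rpow_pos_of_pos hW0 _
  calc c * 2 ^ (-ρ) / (1 + C) ^ 2 * (n * P)⁻¹
      = n * (c * (2 ^ (-ρ) * P)) / ((1 + C) * (n * P)) ^ 2 := by field_simp
    _ ≤ n * heightLaplace q (2 * W) / (1 + n * heightLaplace q W) ^ 2 := by gcongr

lemma exists_collision_le (hd : 2 ≤ d) :
    ∃ C : ℝ, 0 < C ∧ ∀ n : ℕ, 0 < n → ∀ q : EuclideanSpace ℝ (Fin d), ‖q‖ = 1 →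
      ∀ W : ℝ, 1 ≤ W →
      ∫ x, ∑ i : Fin n, attnWeight (W • q) x i ^ 2 ∂(sphereSample d n)
        ≤ C * (n * W ^ (-(((d : ℝ) - 1) / 2)))⁻¹ := by
  obtain ⟨c, hc, hlow⟩ := exists_heightLaplace_ge hd
  refine ⟨20 / c, by positivity, fun n hn q hq W hW => ?_⟩
  have hn0 : (0 : ℝ) < n := by exact_mod_cast hn
  have h1 := hlow q hq W hW
  have h2 : 0 < W ^ (-(((d : ℝ) - 1) / 2)) := Real.rpow_pos_of_pos (by linarith) _
  refine (integral_sum_attnWeight_sq_le hd hn hq (by linarith)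
    ((by positivity : 0 < c * _).trans_le h1)).trans ?_
  calc 20 / (n * heightLaplace q W) ≤ 20 / (n * (c * W ^ (-(((d : ℝ) - 1) / 2)))) := by gcongr
    _ = _ := by field_simp

lemma exp_neg_quarter_le_cube {y : ℝ} (hy : 0 < y) : exp (-(y / 4)) ≤ 1728 * (y⁻¹) ^ 3 := by
  have h := exp_neg_quarter_le (show 0 < y / 3 by positivity)
  have h1 : exp (-(y / 4)) = exp (-(y / 3 / 4)) ^ 3 := by
    rw [← Real.exp_nat_mul]; congr 1; push_cast; ring
  rw [h1]
  calc _ ≤ (4 / (y / 3)) ^ 3 := pow_le_pow_left₀ (exp_pos _).le h 3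
    _ = _ := by field_simp; norm_num

lemma exists_bias_le (hd : 2 ≤ d) :
    ∃ C : ℝ, 0 < C ∧ ∀ n : ℕ, 0 < n → ∀ q : EuclideanSpace ℝ (Fin d), ‖q‖ = 1 →
      ∀ W : ℝ, 1 ≤ W →
      ∫ x, ‖attnMean (n := n) (W • q) x - q‖ ^ 2 ∂(sphereSample d n)
        ≤ C * (W⁻¹ * (n * W ^ (-(((d : ℝ) - 1) / 2)))⁻¹ + (W⁻¹) ^ 2
          + ((n * W ^ (-(((d : ℝ) - 1) / 2)))⁻¹) ^ 3) := by
  obtain ⟨c, hc, hlow⟩ := exists_heightLaplace_ge hd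
  obtain ⟨C, hC, hmom⟩ := exists_heightMoment_le hd
  refine ⟨32 * C / c ^ 2 + 16 * C ^ 2 / c ^ 2 + 4 * 1728 / c ^ 3, by positivity,
    fun n hn q hq W hW => ?_⟩
  have hn0 : (0 : ℝ) < n := by exact_mod_cast hn
  have hW0 : 0 < W := by linarith
  have h1 := hlow q hq W hW
  have h2 := hmom q hq W hW0
  set P := W ^ (-(((d : ℝ) - 1) / 2)) with hP
  have hP0 : 0 < P := Real.rpow_pos_of_pos hW0 _
  have hμ : 0 < heightLaplace q W := (by positivity : 0 < c * P).trans_le h1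
  have hb := heightMoment_nonneg hq W
  have hexp := exp_neg_quarter_le_cube (show 0 < n * heightLaplace q W by positivity)
  refine (integral_norm_attnMean_sub_sq_le hd hn hq hW0.le hμ).trans ?_
  have e1 : 0 ≤ W⁻¹ * (n * P)⁻¹ := by positivity
  have e2 : 0 ≤ (W⁻¹) ^ 2 := by positivity
  have e3 : 0 ≤ ((n * P)⁻¹) ^ 3 := by positivity
  calc _ ≤ 16 / (n * (c * P)) ^ 2 * (2 * (n * (C * (W⁻¹ * P))) + (n * (C * (W⁻¹ * P))) ^ 2)
        + 4 * (1728 * ((n * (c * P))⁻¹) ^ 3) := by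
          refine add_le_add (by gcongr) (mul_le_mul_of_nonneg_left (hexp.trans ?_) (by norm_num))
          gcongr
    _ = 32 * C / c ^ 2 * (W⁻¹ * (n * P)⁻¹) + 16 * C ^ 2 / c ^ 2 * (W⁻¹) ^ 2
        + 4 * 1728 / c ^ 3 * ((n * P)⁻¹) ^ 3 := by field_simp; ring
    _ ≤ _ := by
      have f1 : 0 ≤ 32 * C / c ^ 2 := by positivity
      have f2 : 0 ≤ 16 * C ^ 2 / c ^ 2 := by positivity
      have f3 : 0 ≤ 4 * 1728 / c ^ 3 := by positivity
      generalize 32 * C / c ^ 2 = k1 at *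
      generalize 16 * C ^ 2 / c ^ 2 = k2 at *
      generalize 4 * 1728 / c ^ 3 = k3 at *
      nlinarith [mul_nonneg f1 e2, mul_nonneg f1 e3, mul_nonneg f2 e1, mul_nonneg f2 e3,
        mul_nonneg f3 e1, mul_nonneg f3 e2]

lemma eventually_mul_rpow_neg_lt {C c a b : ℝ} (hc : 0 < c) (hab : b < a) :
    ∀ᶠ x : ℝ in Filter.atTop, C * x ^ (-a) < c * x ^ (-b) := by
  have h := ((tendsto_rpow_neg_atTop (sub_pos.2 hab)).const_mul C)
  rw [mul_zero] at h
  filter_upwards [h.eventually_lt_const hc, Filter.eventually_gt_atTop 0] with x hx hx0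
  have h1 : x ^ (-a) = x ^ (-(a - b)) * x ^ (-b) := by
    rw [← Real.rpow_add hx0]; congr 1; ring
  rw [h1, ← mul_assoc]
  exact mul_lt_mul_of_pos_right hx (Real.rpow_pos_of_pos hx0 _)

/-- Location of the minimizers of the risk along the query direction. -/
lemma exists_attnRisk_minimizer_bounds (hd : 2 ≤ d) :
    ∃ Λ₀ : ℝ, 1 ≤ Λ₀ ∧ ∀ (n : ℕ) (s t Λ : ℝ), 0 < n → 0 < s → t = s * (3 * d * n / Λ) →
      Λ₀ ≤ Λ → Λ ^ (((d : ℝ) + 2) / (d + 4)) ≤ n →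
      ∀ q : EuclideanSpace ℝ (Fin d), ‖q‖ = 1 →
      (∃ w₀ : ℝ, attnRisk n s t (w₀ • q) q < s) ∧
      ∀ w : ℝ, (∀ w' : ℝ, attnRisk n s t (w • q) q ≤ attnRisk n s t (w' • q) q) →
        Λ ^ ((1 : ℝ) / (d + 4)) < w ∧ w < Λ ^ ((2 * ((d : ℝ) + 2)) / (d * (d + 4))) := by
  obtain ⟨c₁, hc₁, hbias⟩ := exists_bias_ge hd
  obtain ⟨c₂, hc₂, hcoll⟩ := exists_collision_ge hd
  obtain ⟨C₃, hC₃, hcoll'⟩ := exists_collision_le hd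
  obtain ⟨C₄, hC₄, hbias'⟩ := exists_bias_le hd
  set D : ℝ := (d : ℝ) with hD
  have hD2 : 2 ≤ D := by rw [hD]; exact_mod_cast hd
  set C := 3 * C₄ + 3 * D * C₃ with hC
  have hev : ∀ᶠ x : ℝ in Filter.atTop, C * x ^ (-(3 / (D + 2))) < c₁ * x ^ (-(2 / (D + 4))) ∧
      C * x ^ (-(3 / (D + 2))) < 3 * D * c₂ * x ^ (-((3 * D + 2) / (D * (D + 4)))) ∧
      C * x ^ (-(3 / (D + 2))) < 1 * x ^ (-(0 : ℝ)) := by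
    refine (eventually_mul_rpow_neg_lt hc₁ ?_).and
      ((eventually_mul_rpow_neg_lt (by positivity) ?_).and
        (eventually_mul_rpow_neg_lt one_pos (by positivity)))
    · rw [div_lt_div_iff₀ (by linarith) (by linarith)]; linarith
    · rw [div_lt_div_iff₀ (by positivity) (by linarith)]; nlinarith
  obtain ⟨Λ₁, hΛ₁⟩ := Filter.eventually_atTop.1 hev
  refine ⟨max 1 Λ₁, le_max_left _ _, fun n s t Λ hn hs ht hΛ hN q hq => ?_⟩
  have hΛ1 : 1 ≤ Λ := (le_max_left _ _).trans hΛ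
  obtain ⟨g1, g2, g3⟩ := hΛ₁ Λ ((le_max_right _ _).trans hΛ)
  have hΛ0 : 0 < Λ := by linarith
  have hn0 : (0 : ℝ) < n := by exact_mod_cast hn
  set ρ := (D - 1) / 2 with hρ
  have hpow : ∀ a : ℝ, (Λ ^ a) ^ (-ρ) = Λ ^ (-(a * ρ)) := fun a => by
    rw [← Real.rpow_mul hΛ0.le]; congr 1; ring
  have hone : ∀ a : ℝ, 0 ≤ a → 1 ≤ Λ ^ a := fun a ha => Real.one_le_rpow hΛ1 ha
  -- the effective sample size at the scale `Λ ^ a`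
  have heff : ∀ a e : ℝ, e ≤ (D + 2) / (D + 4) - a * ρ → Λ ^ e ≤ n * (Λ ^ a) ^ (-ρ) := by
    intro a e he
    rw [hpow]
    calc Λ ^ e ≤ Λ ^ ((D + 2) / (D + 4) + -(a * ρ)) :=
          Real.rpow_le_rpow_of_exponent_le hΛ1 (by linarith)
      _ = Λ ^ ((D + 2) / (D + 4)) * Λ ^ (-(a * ρ)) := Real.rpow_add hΛ0 _ _
      _ ≤ _ := by gcongr
  have hrisk : ∀ w : ℝ, attnRisk n s t (w • q) q
      = s * ((∫ x, ‖attnMean (n := n) (w • q) x - q‖ ^ 2 ∂(sphereSample d n)) +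
        3 * D * n / Λ * ∫ x, ∑ i : Fin n, attnWeight (w • q) x i ^ 2 ∂(sphereSample d n)) := by
    intro w; rw [attnRisk, ht]; ring
  have hvar : ∀ a : ℝ, 3 * D * n / Λ * (n * (Λ ^ a) ^ (-ρ))⁻¹ = 3 * D * Λ ^ (a * ρ - 1) := by
    intro a
    have : Λ ^ (a * ρ - 1) = (Λ ^ (-(a * ρ)))⁻¹ / Λ := by
      rw [Real.rpow_sub hΛ0, Real.rpow_one, Real.rpow_neg hΛ0.le, inv_inv]
    rw [hpow, this]
    have : 0 < Λ ^ (-(a * ρ)) := Real.rpow_pos_of_pos hΛ0 _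
    field_simp
  have hupper : attnRisk n s t ((Λ ^ (2 / (D + 2))) • q) q ≤ s * (C * Λ ^ (-(3 / (D + 2)))) := by
    rw [hrisk]
    refine mul_le_mul_of_nonneg_left ?_ hs.le
    have hW := hone (2 / (D + 2)) (by positivity)
    have h1 := hbias' n hn q hq _ hW
    have h2 := hcoll' n hn q hq _ hW
    have h3 : 3 * D * n / Λ * (∫ x, ∑ i : Fin n,
        attnWeight ((Λ ^ (2 / (D + 2))) • q) x i ^ 2 ∂(sphereSample d n))
        ≤ 3 * D * C₃ * Λ ^ (-(3 / (D + 2))) := by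
      calc _ ≤ 3 * D * n / Λ * (C₃ * (n * (Λ ^ (2 / (D + 2))) ^ (-ρ))⁻¹) := by gcongr
        _ = C₃ * (3 * D * n / Λ * (n * (Λ ^ (2 / (D + 2))) ^ (-ρ))⁻¹) := by ring
        _ = 3 * D * C₃ * Λ ^ (2 / (D + 2) * ρ - 1) := by rw [hvar]; ring
        _ = _ := by congr 2; rw [hρ]; field_simp; ring
    have h4 : (n * (Λ ^ (2 / (D + 2))) ^ (-ρ))⁻¹ ≤ Λ ^ (-(1 / (D + 2))) := by
      rw [Real.rpow_neg hΛ0.le]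
      refine inv_anti₀ (Real.rpow_pos_of_pos hΛ0 _) (heff _ _ ?_)
      rw [hρ, ← sub_nonneg]
      have : (D + 2) / (D + 4) - 2 / (D + 2) * ((D - 1) / 2) - 1 / (D + 2)
          = 4 / ((D + 4) * (D + 2)) := by field_simp; ring
      rw [this]; positivity
    have h5 : (Λ ^ (2 / (D + 2)))⁻¹ = Λ ^ (-(2 / (D + 2))) := (Real.rpow_neg hΛ0.le _).symm
    have h6 : (Λ ^ (2 / (D + 2)))⁻¹ * (n * (Λ ^ (2 / (D + 2))) ^ (-ρ))⁻¹
        ≤ Λ ^ (-(3 / (D + 2))) := by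
      calc _ ≤ (Λ ^ (2 / (D + 2)))⁻¹ * Λ ^ (-(1 / (D + 2))) := by gcongr
        _ = _ := by rw [h5, ← Real.rpow_add hΛ0]; congr 1; ring
    have h7 : ((Λ ^ (2 / (D + 2)))⁻¹) ^ 2 ≤ Λ ^ (-(3 / (D + 2))) := by
      rw [h5, ← Real.rpow_natCast, ← Real.rpow_mul hΛ0.le]
      refine Real.rpow_le_rpow_of_exponent_le hΛ1 ?_
      have : 0 < 1 / (D + 2) := by positivity
      push_cast
      linear_combination this.le
    have h8 : ((n * (Λ ^ (2 / (D + 2))) ^ (-ρ))⁻¹) ^ 3 ≤ Λ ^ (-(3 / (D + 2))) := by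
      calc _ ≤ (Λ ^ (-(1 / (D + 2)))) ^ 3 := by gcongr
        _ = _ := by
          rw [← Real.rpow_natCast, ← Real.rpow_mul hΛ0.le]; congr 1; push_cast; ring
    have h9 := mul_le_mul_of_nonneg_left (add_le_add (add_le_add h6 h7) h8) hC₄.le
    rw [hC]
    linarith
  refine ⟨⟨_, hupper.trans_lt ?_⟩, fun w hw => ⟨?_, ?_⟩⟩
  · rw [neg_zero, Real.rpow_zero, one_mul] at g3
    nlinarith
  · by_contra! hle
    have h1 := hbias n hn q hq (Λ ^ ((1 : ℝ) / (D + 4))) (hone _ (by positivity)) (by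
      refine (hone 0 le_rfl).trans (heff _ _ ?_)
      have : (D + 2) / (D + 4) - 1 / (D + 4) * ρ = (D + 5) / (2 * (D + 4)) := by
        rw [hρ]; field_simp; ring
      rw [this]; positivity) w hle
    have h2 : ((Λ ^ ((1 : ℝ) / (D + 4)))⁻¹) ^ 2 = Λ ^ (-(2 / (D + 4))) := by
      rw [← Real.rpow_neg hΛ0.le, ← Real.rpow_natCast, ← Real.rpow_mul hΛ0.le]
      congr 1; push_cast; ring
    rw [h2] at h1
    have h3 := (hw _).trans hupper
    rw [hrisk] at h3
    have h4 := le_of_mul_le_mul_left h3 hs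
    have h5 : 0 ≤ 3 * D * n / Λ *
        ∫ x, ∑ i : Fin n, attnWeight (w • q) x i ^ 2 ∂(sphereSample d n) :=
      mul_nonneg (by positivity)
        (integral_nonneg fun x => Finset.sum_nonneg fun i _ => sq_nonneg _)
    linarith
  · by_contra! hle
    have h1 := hcoll n hn q hq (Λ ^ ((2 * (D + 2)) / (D * (D + 4)))) (hone _ (by positivity)) (by
      refine (hone 0 le_rfl).trans (heff _ _ ?_)
      have : (D + 2) / (D + 4) - (2 * (D + 2)) / (D * (D + 4)) * ρ
          = (D + 2) / (D * (D + 4)) := by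
        rw [hρ]; field_simp; ring
      rw [this]; positivity) w hle
    have h2 : 3 * D * c₂ * Λ ^ (-((3 * D + 2) / (D * (D + 4)))) ≤ 3 * D * n / Λ *
        ∫ x, ∑ i : Fin n, attnWeight (w • q) x i ^ 2 ∂(sphereSample d n) := by
      calc _ = c₂ * (3 * D * Λ ^ ((2 * (D + 2)) / (D * (D + 4)) * ρ - 1)) := by
            have : (2 * (D + 2)) / (D * (D + 4)) * ρ - 1 = -((3 * D + 2) / (D * (D + 4))) := by
              rw [hρ]; field_simp; ring
            rw [this]; ring
        _ = 3 * D * n / Λ * (c₂ * (n * (Λ ^ ((2 * (D + 2)) / (D * (D + 4)))) ^ (-ρ))⁻¹) := by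
            rw [← hvar]; ring
        _ ≤ _ := by gcongr
    have h3 := (hw _).trans hupper
    rw [hrisk] at h3
    have h4 := le_of_mul_le_mul_left h3 hs
    have h5 : 0 ≤ ∫ x, ‖attnMean (n := n) (w • q) x - q‖ ^ 2 ∂(sphereSample d n) :=
      integral_nonneg fun x => sq_nonneg _
    linarith

end Scaling

end Helpers

/-- Theorem 4 (Case 1, affine tasks): there are constants depending only on `d` such that,
under the stated conditions on `n, L, σ`, every global minimizer over `ℝ^{d×d}` of the
softmax-attention ICL pretraining loss with tasks drawn from `D(F^aff_L)` equals `w • I_d`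
with `c₁ Λ^{1/(d+4)} ≤ |w| ≤ c₂ Λ^{2(d+2)/(d(d+4))}`, where `Λ = n L² / σ²`. -/
theorem affine_pretraining_minimizer_scaling (d : ℕ) (hd : 2 ≤ d) :
    ∃ N0 a1 a2 c1 c2 : ℝ,
      0 < N0 ∧ 0 < a1 ∧ 0 < a2 ∧ 0 < c1 ∧ 0 < c2 ∧
      ∀ (n : ℕ) (L σ : ℝ) (ν : Measure ℝ),
        0 < L → 0 < σ →
        IsProbabilityMeasure ν →
        Integrable (fun t : ℝ => t ^ 2) ν →
        (∫ t, t ∂ν) = 0 →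
        (∫ t, t ^ 2 ∂ν) = σ ^ 2 →
        a1 * (n : ℝ) ^ (-(d : ℝ) / 2) ≤ σ ^ 2 →
        σ ^ 2 ≤ a2 * n * L ^ 2 →
        N0 ≤ (n : ℝ) →
        N0 * (L * (Real.log n) ^ 2 / σ) ^ (d + 2) ≤ (n : ℝ) →
        ∀ Mstar : Matrix (Fin d) (Fin d) ℝ,
          (∀ M : Matrix (Fin d) (Fin d) ℝ,
            iclLoss d n (affineTask d L) ν affineF Mstar ≤
              iclLoss d n (affineTask d L) ν affineF M) →
          ∃ w : ℝ,
            Mstar = w • (1 : Matrix (Fin d) (Fin d) ℝ) ∧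
            c1 * ((n : ℝ) * L ^ 2 / σ ^ 2) ^ ((1 : ℝ) / ((d : ℝ) + 4)) ≤ |w| ∧
            |w| ≤ c2 * ((n : ℝ) * L ^ 2 / σ ^ 2) ^
              ((2 * ((d : ℝ) + 2)) / ((d : ℝ) * ((d : ℝ) + 4))) := by
  obtain ⟨Λ₀, hΛ₀, hbounds⟩ := exists_attnRisk_minimizer_bounds hd
  have hΛ₀' : 0 < Λ₀ := by linarith
  refine ⟨3, 1, 1 / Λ₀, 1, 1, by norm_num, one_pos, by positivity, one_pos, one_pos, ?_⟩
  intro n L σ ν hL hσ _ h2 h0 hvar _ hσn hn3 hnL M hM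
  have hn0 : (0 : ℝ) < n := by linarith
  have hn : 0 < n := by exact_mod_cast hn0
  have hd0 : (0 : ℝ) < d := by exact_mod_cast (by lia : 0 < d)
  obtain ⟨q, hq⟩ := exists_unit_vector hd
  set Λ := (n : ℝ) * L ^ 2 / σ ^ 2 with hΛ
  have hΛ0 : 0 < Λ := by positivity
  have hlarge : Λ₀ ≤ Λ := by
    rw [hΛ, le_div_iff₀ (by positivity)]
    calc Λ₀ * σ ^ 2 ≤ Λ₀ * (1 / Λ₀ * n * L ^ 2) := by gcongr
      _ = _ := by field_simp
  have hlog : 1 ≤ Real.log n := by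
    rw [Real.le_log_iff_exp_le hn0]
    linarith [Real.exp_one_lt_d9]
  have hratio : (L / σ) ^ (d + 2) ≤ n := by
    calc (L / σ) ^ (d + 2) ≤ (L * Real.log n ^ 2 / σ) ^ (d + 2) := by
          gcongr; exact le_mul_of_one_le_right hL.le (one_le_pow₀ hlog)
      _ ≤ 3 * (L * Real.log n ^ 2 / σ) ^ (d + 2) := by
          have : 0 ≤ (L * Real.log n ^ 2 / σ) ^ (d + 2) := by positivity
          linarith
      _ ≤ n := hnL
  have hpow : Λ ^ (d + 2) ≤ (n : ℝ) ^ (d + 4) := by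
    calc Λ ^ (d + 2) = (n : ℝ) ^ (d + 2) * ((L / σ) ^ (d + 2)) ^ 2 := by
          rw [hΛ, ← pow_mul, mul_comm (d + 2) 2, pow_mul, ← mul_pow]; congr 1; field_simp
      _ ≤ (n : ℝ) ^ (d + 2) * (n : ℝ) ^ 2 := by gcongr
      _ = _ := by rw [← pow_add]
  have hsize : Λ ^ (((d : ℝ) + 2) / (d + 4)) ≤ n := by
    have h := Real.rpow_le_rpow (by positivity) hpow
      (by positivity : (0 : ℝ) ≤ 1 / ((d : ℝ) + 4))
    rw [← Real.rpow_natCast, ← Real.rpow_natCast, ← Real.rpow_mul hΛ0.le,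
      ← Real.rpow_mul hn0.le] at h
    push_cast at h
    rwa [mul_one_div, mul_one_div, div_self (by positivity), Real.rpow_one] at h
  obtain ⟨⟨w₀, hw₀⟩, hmin⟩ := hbounds n (L ^ 2 / (3 * d)) (∫ t, t ^ 2 ∂ν) Λ hn (by positivity)
    (by rw [hvar, hΛ]; field_simp) hlarge hsize q hq
  obtain ⟨w, rfl, hw⟩ := exists_smul_one_of_minimizer hd hn hL h2 h0 hq hw₀ hM
  obtain ⟨h1, h3⟩ := hmin w hw
  have hw0 : 0 < w := (Real.rpow_pos_of_pos hΛ0 _).trans h1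
  refine ⟨w, rfl, ?_, ?_⟩ <;> rw [abs_of_pos hw0, one_mul]
  exacts [h1.le, h3.le]
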